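/- arXiv:2309.00103 — 2 statements merged into one kernel-verified Lean document; each statement's English description precedes it below -/
import Mathlib

section
/- Let d, n ≥ 1 be integers and 0 ≤ δ ≤ 1, and for each i ∈ {1, …, n} let X_i, X'_i, Y_i and Y'_i be measurable subsets of ℝ^d of finite positive Lebesgue measure with |X_i △ X'_i| ≤ δ·|X_i| and |Y_i △ Y'_i| ≤ δ·|Y_i|. Then for points y_i chosen independently and uniformly at random from Y_i, and y'_i chosen independently and uniformly at random from Y'_i, one has |E(|⋃_{i=1}^n (X'_i + y'_i)|) − E(|⋃_{i=1}^n (X_i + y_i)|)| ≤ 4nδ·Σ_{i=1}^n |X_i|. -/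
open MeasureTheory

/-- The expected volume of `⋃ i, (X i + y i)` when each `y i` is chosen independently
and uniformly at random from `Y i`. -/
noncomputable def expUnion {d n : ℕ} (X Y : Fin n → Set (EuclideanSpace ℝ (Fin d))) : ℝ :=
  ((∏ i, volume (Y i))⁻¹ *
    ∫⁻ y in Set.univ.pi Y, volume (⋃ i, (· + y i) '' (X i))).toReal

open scoped ENNReal

theorem lintegral_pi_le_add_of_forall_lintegral_le_add {α : Type*} [MeasurableSpace α] {n : ℕ}
    (μ ν : Fin n → Measure α) [∀ i, IsProbabilityMeasure (μ i)]
    [∀ i, IsProbabilityMeasure (ν i)] (c M : ℝ≥0∞)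
    (h : ∀ i, ∀ f : α → ℝ≥0∞, Measurable f → (∀ x, f x ≤ M) →
      ∫⁻ x, f x ∂μ i ≤ ∫⁻ x, f x ∂ν i + c)
    (g : (Fin n → α) → ℝ≥0∞) (hg : Measurable g) (hgM : ∀ x, g x ≤ M) :
    ∫⁻ x, g x ∂Measure.pi μ ≤ ∫⁻ x, g x ∂Measure.pi ν + n * c := by
  induction n with
  | zero =>
    rw [Subsingleton.elim μ ν]
    exact le_self_add
  | succ n ih =>
    have key : ∀ (ρ : Fin (n + 1) → Measure α) [∀ i, IsProbabilityMeasure (ρ i)],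
        ∫⁻ x, g x ∂Measure.pi ρ =
          ∫⁻ a, ∫⁻ t, g (Fin.cons a t) ∂Measure.pi (fun i => ρ i.succ) ∂ρ 0 := by
      intro ρ _
      have e := (measurePreserving_piFinSuccAbove ρ 0).symm
      rw [← e.lintegral_comp hg, lintegral_prod]
      · simp [MeasurableEquiv.piFinSuccAbove, Fin.insertNthEquiv]
      · exact (hg.comp (MeasurableEquiv.measurable _)).aemeasurable
    have hm : Measurable fun p : α × (Fin n → α) =>
        g (Fin.cons (α := fun _ => α) p.1 p.2) := by
      refine hg.comp (measurable_pi_iff.2 fun i => ?_)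
      cases i using Fin.cases with
      | zero => exact measurable_fst
      | succ j => exact (measurable_pi_apply j).comp measurable_snd
    rw [key μ, key ν]
    calc ∫⁻ a, ∫⁻ t, g (Fin.cons a t) ∂Measure.pi (fun i : Fin n => μ i.succ) ∂μ 0
        ≤ ∫⁻ a, (∫⁻ t, g (Fin.cons a t) ∂Measure.pi (fun i : Fin n => ν i.succ) + n * c) ∂μ 0 := by
          refine lintegral_mono fun a => ?_
          exact ih (fun i => μ i.succ) (fun i => ν i.succ) (fun i => h i.succ) _
            (hm.comp measurable_prodMk_left) fun _ => hgM _
      _ = ∫⁻ a, ∫⁻ t, g (Fin.cons a t) ∂Measure.pi (fun i : Fin n => ν i.succ) ∂μ 0 + n * c := by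
          rw [lintegral_add_right _ measurable_const]
          simp
      _ ≤ (∫⁻ a, ∫⁻ t, g (Fin.cons a t) ∂Measure.pi (fun i : Fin n => ν i.succ) ∂ν 0 + c) +
            n * c := by
          gcongr
          refine h 0 _ hm.lintegral_prod_right' fun a => ?_
          calc ∫⁻ t, g (Fin.cons a t) ∂Measure.pi (fun i : Fin n => ν i.succ)
              ≤ ∫⁻ _, M ∂Measure.pi (fun i : Fin n => ν i.succ) := lintegral_mono fun _ => hgM _
            _ = M := by simp
      _ = _ := by push_cast; ring

theorem setLIntegral_le_add_mul_measure_symmDiff {α : Type*} [MeasurableSpace α] (μ : Measure α)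
    (s t : Set α) {f : α → ℝ≥0∞} {M : ℝ≥0∞} (hM : ∀ x, f x ≤ M) :
    ∫⁻ x in s, f x ∂μ ≤ ∫⁻ x in t, f x ∂μ + M * μ (symmDiff s t) := by
  calc ∫⁻ x in s, f x ∂μ ≤ ∫⁻ x in t ∪ symmDiff s t, f x ∂μ :=
        lintegral_mono_set fun x hx => by
          by_cases h : x ∈ t <;> simp [Set.mem_symmDiff, hx, h]
    _ ≤ ∫⁻ x in t, f x ∂μ + ∫⁻ x in symmDiff s t, f x ∂μ := lintegral_union_le _ _ _
    _ ≤ ∫⁻ x in t, f x ∂μ + ∫⁻ _ in symmDiff s t, M ∂μ := by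
        gcongr with x
        exact hM x
    _ = _ := by simp

theorem measure_le_add_measure_symmDiff {α : Type*} [MeasurableSpace α] (μ : Measure α)
    (s t : Set α) : μ s ≤ μ t + μ (symmDiff s t) :=
  (measure_mono fun x hx => by
    by_cases h : x ∈ t <;> simp [Set.mem_symmDiff, hx, h]).trans (measure_union_le _ _)

theorem inv_measure_mul_setLIntegral_le {α : Type*} [MeasurableSpace α] (μ : Measure α) {s : Set α}
    (hs0 : μ s ≠ 0) (hs1 : μ s ≠ ∞) {f : α → ℝ≥0∞} {M : ℝ≥0∞} (hM : ∀ x, f x ≤ M) :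
    (μ s)⁻¹ * ∫⁻ x in s, f x ∂μ ≤ M := by
  calc (μ s)⁻¹ * ∫⁻ x in s, f x ∂μ ≤ (μ s)⁻¹ * ∫⁻ _ in s, M ∂μ := by
        gcongr with x
        exact hM x
    _ = M := by
        rw [setLIntegral_const, mul_comm, mul_assoc, ENNReal.mul_inv_cancel hs0 hs1, mul_one]

theorem inv_measure_mul_setLIntegral_le_add_of_symmDiff {α : Type*} [MeasurableSpace α]
    (μ : Measure α) {s t : Set α} (ht0 : μ t ≠ 0) (ht1 : μ t ≠ ∞) {c : ℝ≥0∞}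
    (hc : μ (symmDiff s t) ≤ c * μ s) {f : α → ℝ≥0∞} {M : ℝ≥0∞} (hM : ∀ x, f x ≤ M) :
    (μ s)⁻¹ * ∫⁻ x in s, f x ∂μ ≤ (μ t)⁻¹ * ∫⁻ x in t, f x ∂μ + 2 * c * M := by
  have hP := inv_measure_mul_setLIntegral_le μ ht0 ht1 hM
  have hQ : ∫⁻ x in t, f x ∂μ = μ t * ((μ t)⁻¹ * ∫⁻ x in t, f x ∂μ) := by
    rw [← mul_assoc, ENNReal.mul_inv_cancel ht0 ht1, one_mul]
  set P := (μ t)⁻¹ * ∫⁻ x in t, f x ∂μ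
  have hts : μ t ≤ μ s + c * μ s :=
    (measure_le_add_measure_symmDiff μ t s).trans (by rw [symmDiff_comm]; gcongr)
  rw [mul_comm, ← div_eq_mul_inv]
  refine ENNReal.div_le_of_le_mul ?_
  calc ∫⁻ x in s, f x ∂μ ≤ μ t * P + M * μ (symmDiff s t) :=
        hQ ▸ setLIntegral_le_add_mul_measure_symmDiff μ s t hM
    _ ≤ (μ s + c * μ s) * P + M * (c * μ s) := by gcongr
    _ = μ s * P + c * μ s * P + M * (c * μ s) := by ring
    _ ≤ μ s * P + c * μ s * M + M * (c * μ s) := by gcongr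
    _ = (P + 2 * c * M) * μ s := by ring

theorem inv_measure_mul_setLIntegral_le_add_of_symmDiff' {α : Type*} [MeasurableSpace α]
    (μ : Measure α) {s t : Set α} (hs0 : μ s ≠ 0) (hs1 : μ s ≠ ∞) (ht0 : μ t ≠ 0) (ht1 : μ t ≠ ∞) {c : ℝ≥0∞}
    (hc : μ (symmDiff s t) ≤ c * μ s) {f : α → ℝ≥0∞} {M : ℝ≥0∞} (hM : ∀ x, f x ≤ M) :
    (μ t)⁻¹ * ∫⁻ x in t, f x ∂μ ≤ (μ s)⁻¹ * ∫⁻ x in s, f x ∂μ + 2 * c * M := by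
  have hP := inv_measure_mul_setLIntegral_le μ ht0 ht1 hM
  have hQ : ∫⁻ x in t, f x ∂μ = μ t * ((μ t)⁻¹ * ∫⁻ x in t, f x ∂μ) := by
    rw [← mul_assoc, ENNReal.mul_inv_cancel ht0 ht1, one_mul]
  have hR : ∫⁻ x in s, f x ∂μ = μ s * ((μ s)⁻¹ * ∫⁻ x in s, f x ∂μ) := by
    rw [← mul_assoc, ENNReal.mul_inv_cancel hs0 hs1, one_mul]
  have hI : ∫⁻ x in t, f x ∂μ ≤ ∫⁻ x in s, f x ∂μ + M * (c * μ s) :=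
    (setLIntegral_le_add_mul_measure_symmDiff μ t s hM).trans (by rw [symmDiff_comm]; gcongr)
  set P := (μ t)⁻¹ * ∫⁻ x in t, f x ∂μ
  set R := (μ s)⁻¹ * ∫⁻ x in s, f x ∂μ
  have hst : μ s ≤ μ t + c * μ s := (measure_le_add_measure_symmDiff μ s t).trans (by gcongr)
  refine (ENNReal.mul_le_mul_iff_right hs0 hs1).1 ?_
  calc μ s * P ≤ (μ t + c * μ s) * P := by gcongr
    _ = μ t * P + c * μ s * P := by ring
    _ ≤ (μ s * R + M * (c * μ s)) + c * μ s * M := by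
        rw [← hQ, ← hR]
        gcongr
    _ = μ s * (R + 2 * c * M) := by ring

theorem pi_smul_measure {ι : Type*} [Fintype ι] {α : ι → Type*} [∀ i, MeasurableSpace (α i)]
    (c : ι → ℝ≥0∞) (ν : ∀ i, Measure (α i)) [∀ i, SigmaFinite (ν i)]
    [∀ i, SigmaFinite (c i • ν i)] :
    Measure.pi (fun i => c i • ν i) = (∏ i, c i) • Measure.pi ν :=
  Measure.pi_eq fun s _ => by simp [Measure.pi_pi, Finset.prod_mul_distrib]

theorem expUnion_eq_lintegral_pi_cond {d n : ℕ} (X Y : Fin n → Set (EuclideanSpace ℝ (Fin d)))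
    (hY0 : ∀ i, volume (Y i) ≠ 0) (hY1 : ∀ i, volume (Y i) ≠ ∞) :
    expUnion X Y = (∫⁻ y, volume (⋃ i, (· + y i) '' (X i))
      ∂Measure.pi fun i => ProbabilityTheory.cond volume (Y i)).toReal := by
  have hp : ∀ i, IsProbabilityMeasure (ProbabilityTheory.cond volume (Y i)) := fun i =>
    ProbabilityTheory.cond_isProbabilityMeasure_of_finite (hY0 i) (hY1 i)
  have hσ : ∀ i, SigmaFinite ((volume (Y i))⁻¹ • volume.restrict (Y i)) := fun i =>
    inferInstanceAs (SigmaFinite (ProbabilityTheory.cond volume (Y i)))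
  have h : (Measure.pi fun i => ProbabilityTheory.cond volume (Y i)) =
      (∏ i, volume (Y i))⁻¹ • volume.restrict (Set.univ.pi Y) := by
    unfold ProbabilityTheory.cond
    rw [pi_smul_measure, volume_pi, Measure.restrict_pi_pi,
      ENNReal.prod_inv_distrib fun i _ j _ _ => Or.inl (hY0 i)]
  rw [h, lintegral_smul_measure]
  rfl

theorem measurable_volume_iUnion_translate {d n : ℕ} {X : Fin n → Set (EuclideanSpace ℝ (Fin d))}
    (hX : ∀ i, MeasurableSet (X i)) :
    Measurable fun y : Fin n → EuclideanSpace ℝ (Fin d) =>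
      volume (⋃ i, (· + y i) '' (X i)) := by
  have hs : MeasurableSet {p : (Fin n → EuclideanSpace ℝ (Fin d)) × EuclideanSpace ℝ (Fin d) |
      ∃ i, p.2 - p.1 i ∈ X i} := by
    rw [Set.ofPred_exists]
    refine MeasurableSet.iUnion fun i => ?_
    exact (measurable_snd.sub ((measurable_pi_apply i).comp measurable_fst)) (hX i)
  convert measurable_measure_prodMk_left (ν := volume) hs using 3 with y
  ext x
  simp [sub_eq_add_neg]

theorem volume_iUnion_translate_le {d n : ℕ} (X : Fin n → Set (EuclideanSpace ℝ (Fin d)))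
    (y : Fin n → EuclideanSpace ℝ (Fin d)) :
    volume (⋃ i, (· + y i) '' (X i)) ≤ ∑ i, volume (X i) :=
  (measure_iUnion_fintype_le _ _).trans (by simp)

theorem volume_iUnion_translate_le_add_symmDiff {d n : ℕ}
    (X X' : Fin n → Set (EuclideanSpace ℝ (Fin d))) (y : Fin n → EuclideanSpace ℝ (Fin d)) :
    volume (⋃ i, (· + y i) '' (X i)) ≤
      volume (⋃ i, (· + y i) '' (X' i)) + ∑ i, volume (symmDiff (X i) (X' i)) := by
  refine le_trans (measure_mono ?_) ((measure_union_le _ _).trans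
    (add_le_add_right (volume_iUnion_translate_le _ y) _))
  rw [← Set.iUnion_union_distrib]
  refine Set.iUnion_mono fun i => ?_
  rw [← Set.image_union]
  refine Set.image_mono fun x hx => ?_
  by_cases h : x ∈ X' i <;> simp [Set.mem_symmDiff, hx, h]

theorem stmt6 (d n : ℕ) (hd : 1 ≤ d) (hn : 1 ≤ n) (δ : ℝ) (hδ0 : 0 ≤ δ) (hδ1 : δ ≤ 1)
    (X X' Y Y' : Fin n → Set (EuclideanSpace ℝ (Fin d)))
    (hXm : ∀ i, MeasurableSet (X i)) (hX'm : ∀ i, MeasurableSet (X' i))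
    (hYm : ∀ i, MeasurableSet (Y i)) (hY'm : ∀ i, MeasurableSet (Y' i))
    (hX0 : ∀ i, 0 < volume (X i)) (hX1 : ∀ i, volume (X i) < ⊤)
    (hX'0 : ∀ i, 0 < volume (X' i)) (hX'1 : ∀ i, volume (X' i) < ⊤)
    (hY0 : ∀ i, 0 < volume (Y i)) (hY1 : ∀ i, volume (Y i) < ⊤)
    (hY'0 : ∀ i, 0 < volume (Y' i)) (hY'1 : ∀ i, volume (Y' i) < ⊤)
    (hXd : ∀ i, (volume (symmDiff (X i) (X' i))).toReal ≤ δ * (volume (X i)).toReal)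
    (hYd : ∀ i, (volume (symmDiff (Y i) (Y' i))).toReal ≤ δ * (volume (Y i)).toReal) :
    |expUnion X' Y' - expUnion X Y| ≤ 4 * n * δ * ∑ i, (volume (X i)).toReal := by
  have hS : ∑ i, volume (X i) ≠ ∞ := ENNReal.sum_ne_top.2 fun i _ => (hX1 i).ne
  have ofReal_le : ∀ {a b : ℝ≥0∞}, a ≠ ∞ → b ≠ ∞ → a.toReal ≤ δ * b.toReal →
      a ≤ ENNReal.ofReal δ * b := fun ha hb h => by
    rw [← ENNReal.toReal_le_toReal ha (ENNReal.mul_ne_top ENNReal.ofReal_ne_top hb),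
      ENNReal.toReal_mul, ENNReal.toReal_ofReal hδ0]
    exact h
  have symm_ne_top : ∀ {A B : Set (EuclideanSpace ℝ (Fin d))}, volume A < ⊤ → volume B < ⊤ →
      volume (symmDiff A B) ≠ ∞ := fun hA hB =>
    ((measure_mono Set.symmDiff_subset_union).trans_lt (measure_union_lt_top hA hB)).ne
  have hYd' (i) := ofReal_le (symm_ne_top (hY1 i) (hY'1 i)) (hY1 i).ne (hYd i)
  have hXs : ∑ i, volume (symmDiff (X i) (X' i)) ≤ ENNReal.ofReal δ * ∑ i, volume (X i) := by
    rw [Finset.mul_sum]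
    exact Finset.sum_le_sum fun i _ =>
      ofReal_le (symm_ne_top (hX1 i) (hX'1 i)) (hX1 i).ne (hXd i)
  have hXs' : ∑ i, volume (symmDiff (X' i) (X i)) ≤ ENNReal.ofReal δ * ∑ i, volume (X i) := by
    simpa only [symmDiff_comm] using hXs
  have hp : ∀ i, IsProbabilityMeasure (ProbabilityTheory.cond volume (Y i)) := fun i =>
    ProbabilityTheory.cond_isProbabilityMeasure_of_finite (hY0 i).ne' (hY1 i).ne
  have hp' : ∀ i, IsProbabilityMeasure (ProbabilityTheory.cond volume (Y' i)) := fun i =>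
    ProbabilityTheory.cond_isProbabilityMeasure_of_finite (hY'0 i).ne' (hY'1 i).ne
  rw [expUnion_eq_lintegral_pi_cond X Y (fun i => (hY0 i).ne') fun i => (hY1 i).ne,
    expUnion_eq_lintegral_pi_cond X' Y' (fun i => (hY'0 i).ne') fun i => (hY'1 i).ne,
    ← ENNReal.toReal_sum fun i _ => (hX1 i).ne]
  set S := ∑ i, volume (X i)
  set c := ENNReal.ofReal δ with hc
  let μ := fun i => ProbabilityTheory.cond volume (Y i)
  have : ∀ i, IsProbabilityMeasure (μ i) := hp
  let μ' := fun i => ProbabilityTheory.cond volume (Y' i)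
  have : ∀ i, IsProbabilityMeasure (μ' i) := hp'
  set g := fun y : Fin n → EuclideanSpace ℝ (Fin d) => volume (⋃ i, (· + y i) '' (X i))
  set g' := fun y : Fin n → EuclideanSpace ℝ (Fin d) => volume (⋃ i, (· + y i) '' (X' i))
  have hgm : Measurable g := measurable_volume_iUnion_translate hXm
  have hgS : ∀ y, g y ≤ S := volume_iUnion_translate_le X
  have hμ : ∫⁻ y, g y ∂Measure.pi μ ≤ ∫⁻ y, g y ∂Measure.pi μ' + n * (2 * c * S) := by
    refine lintegral_pi_le_add_of_forall_lintegral_le_add μ μ' _ S (fun i f _ hf => ?_) g hgm hgS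
    simpa only [μ, μ', ProbabilityTheory.cond, lintegral_smul_measure, smul_eq_mul] using
      inv_measure_mul_setLIntegral_le_add_of_symmDiff volume (hY'0 i).ne' (hY'1 i).ne
        (hYd' i) hf
  have hμ' : ∫⁻ y, g y ∂Measure.pi μ' ≤ ∫⁻ y, g y ∂Measure.pi μ + n * (2 * c * S) := by
    refine lintegral_pi_le_add_of_forall_lintegral_le_add μ' μ _ S (fun i f _ hf => ?_) g hgm hgS
    simpa only [μ, μ', ProbabilityTheory.cond, lintegral_smul_measure, smul_eq_mul] using
      inv_measure_mul_setLIntegral_le_add_of_symmDiff' volume (hY0 i).ne' (hY1 i).ne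
        (hY'0 i).ne' (hY'1 i).ne (hYd' i) hf
  have hg : ∫⁻ y, g y ∂Measure.pi μ' ≤ ∫⁻ y, g' y ∂Measure.pi μ' + c * S := by
    calc ∫⁻ y, g y ∂Measure.pi μ' ≤ ∫⁻ y, (g' y + c * S) ∂Measure.pi μ' :=
          lintegral_mono fun y => (volume_iUnion_translate_le_add_symmDiff X X' y).trans
            (add_le_add_right hXs _)
      _ = _ := by rw [lintegral_add_right _ measurable_const]; simp
  have hg' : ∫⁻ y, g' y ∂Measure.pi μ' ≤ ∫⁻ y, g y ∂Measure.pi μ' + c * S := by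
    calc ∫⁻ y, g' y ∂Measure.pi μ' ≤ ∫⁻ y, (g y + c * S) ∂Measure.pi μ' :=
          lintegral_mono fun y => (volume_iUnion_translate_le_add_symmDiff X' X y).trans
            (add_le_add_right hXs' _)
      _ = _ := by rw [lintegral_add_right _ measurable_const]; simp
  have hcS : c * S ≠ ∞ := ENNReal.mul_ne_top ENNReal.ofReal_ne_top hS
  have hncS : n * (2 * c * S) ≠ ∞ := by
    rw [mul_assoc]
    exact ENNReal.mul_ne_top (ENNReal.natCast_ne_top n) (ENNReal.mul_ne_top (by simp) hcS)
  have hA : ∫⁻ y, g y ∂Measure.pi μ ≠ ∞ := ne_top_of_le_ne_top hS <|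
    (lintegral_mono hgS).trans (by simp)
  have hB : ∫⁻ y, g y ∂Measure.pi μ' ≠ ∞ := ne_top_of_le_ne_top (by finiteness) hμ'
  have hB' : ∫⁻ y, g' y ∂Measure.pi μ' ≠ ∞ := ne_top_of_le_ne_top (by finiteness) hg'
  have toReal_le : ∀ {a b e : ℝ≥0∞}, b ≠ ∞ → e ≠ ∞ → a ≤ b + e →
      a.toReal ≤ b.toReal + e.toReal := fun hb he h =>
    (ENNReal.toReal_mono (ENNReal.add_ne_top.2 ⟨hb, he⟩) h).trans ENNReal.toReal_add_le
  have h1 := toReal_le hB hncS hμ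
  have h2 := toReal_le hA hncS hμ'
  have h3 := toReal_le hB' hcS hg
  have h4 := toReal_le hB hcS hg'
  simp only [ENNReal.toReal_mul, ENNReal.toReal_natCast, ENNReal.toReal_ofNat, hc,
    ENNReal.toReal_ofReal hδ0] at h1 h2 h3 h4
  have hn' : δ * S.toReal ≤ n * (δ * S.toReal) :=
    le_mul_of_one_le_left (mul_nonneg hδ0 ENNReal.toReal_nonneg) (by exact_mod_cast hn)
  have h0 : 0 ≤ δ * S.toReal := mul_nonneg hδ0 ENNReal.toReal_nonneg
  rw [abs_le]
  constructor <;> linarith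
end

section
/- Let d, n ≥ 1 be integers, let M ∈ SL_d(ℤ), and let X_1, …, X_n and Y_1, …, Y_n be measurable subsets of positive measure of the torus T^d. For each i, let X_i^M and Y_i^M be Steiner symmetrizations of X_i and Y_i with respect to M. Then for points y_i chosen independently and uniformly at random from Y_i, and y_i^M chosen independently and uniformly at random from Y_i^M, one has E(|⋃_{i=1}^n (X_i + y_i)|) ≥ E(|⋃_{i=1}^n (X_i^M + y_i^M)|). -/
open MeasureTheory

/-- The circle `ℝ/ℤ`. -/
abbrev 𝕋 := AddCircle (1 : ℝ)

/-- The measure-preserving map of `𝕋^d` induced by an integer matrix `M`. -/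
noncomputable def mmap {d : ℕ} (M : Matrix (Fin d) (Fin d) ℤ) (x : Fin d → 𝕋) : Fin d → 𝕋 :=
  fun i => ∑ j, M i j • x j

/-- `XM` is a Steiner symmetrization of `X` with respect to `M ∈ SL_{d+1}(ℤ)`: for almost
every `u ∈ 𝕋^d`, the section of `M(XM)` over `u` is a closed interval in `𝕋` centred at `0`
(possibly empty) whose measure equals that of the corresponding section of `M(X)`.
Here `𝕋^{d+1}` is identified with `𝕋 × 𝕋^d` via `Fin.cons`. -/
def IsSteinerT {d : ℕ} (M : Matrix (Fin (d + 1)) (Fin (d + 1)) ℤ)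
    (X XM : Set (Fin (d + 1) → 𝕋)) : Prop :=
  ∀ᵐ u : Fin d → 𝕋, ∃ c : ℝ, 0 ≤ c ∧ c ≤ 1 / 2 ∧
    ({x : 𝕋 | Fin.cons x u ∈ mmap M '' XM} = (fun r : ℝ => (r : 𝕋)) '' Set.Icc (-c) c ∨
      {x : 𝕋 | Fin.cons x u ∈ mmap M '' XM} = ∅) ∧
    volume {x : 𝕋 | Fin.cons x u ∈ mmap M '' XM} =
      volume {x : 𝕋 | Fin.cons x u ∈ mmap M '' X}

/-- The expected (Haar) measure of `⋃ i, (X i + y i)` in the torus `𝕋^d`, where each `y i`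
is chosen independently and uniformly at random from `Y i`. -/
noncomputable def expUnionT {d n : ℕ} (X Y : Fin n → Set (Fin d → 𝕋)) : ℝ :=
  ((∏ i, volume (Y i))⁻¹ *
    ∫⁻ y in Set.univ.pi Y, volume (⋃ i, (· + y i) '' (X i))).toReal

open Set Topology Filter
open scoped ENNReal symmDiff

instance : IsProbabilityMeasure (volume : Measure 𝕋) := ⟨by simp⟩

/-- The convolution of the indicator functions of `A` and `B`. -/
noncomputable def overlap (A B : Set 𝕋) (x : 𝕋) : ℝ≥0∞ :=
  volume (A ∩ {s | x - s ∈ B})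

lemma measurableSet_overlap {A B : Set 𝕋} (hA : MeasurableSet A) (hB : MeasurableSet B) :
    MeasurableSet {p : 𝕋 × 𝕋 | p.2 ∈ A ∧ p.1 - p.2 ∈ B} :=
  (measurable_snd hA).inter ((measurable_fst.sub measurable_snd) hB)

lemma measurable_overlap {A B : Set 𝕋} (hA : MeasurableSet A) (hB : MeasurableSet B) :
    Measurable (overlap A B) :=
  measurable_measure_prodMk_left (measurableSet_overlap hA hB)

lemma lintegral_overlap {A B : Set 𝕋} (hA : MeasurableSet A) (hB : MeasurableSet B) :
    ∫⁻ x, overlap A B x = volume A * volume B := by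
  have h1 : ∫⁻ x, overlap A B x =
      (volume : Measure (𝕋 × 𝕋)) {p : 𝕋 × 𝕋 | p.2 ∈ A ∧ p.1 - p.2 ∈ B} :=
    (Measure.prod_apply (measurableSet_overlap hA hB)).symm
  rw [h1, Measure.volume_eq_prod, Measure.prod_apply_symm (measurableSet_overlap hA hB)]
  have h2 : ∀ s : 𝕋, volume ((fun x => (x, s)) ⁻¹' {p : 𝕋 × 𝕋 | p.2 ∈ A ∧ p.1 - p.2 ∈ B}) =
      A.indicator (fun _ => volume B) s := by
    intro s
    by_cases hs : s ∈ A
    · rw [indicator_of_mem hs, ← (measurePreserving_sub_right volume s).measure_preimage hB.nullMeasurableSet]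
      congr 1
      ext x
      simp [hs]
    · simp [hs]
  simp_rw [h2]
  rw [lintegral_indicator_const hA, mul_comm]

lemma overlap_le_left (A B : Set 𝕋) (x : 𝕋) : overlap A B x ≤ volume A :=
  measure_mono inter_subset_left

lemma overlap_ne_top (A B : Set 𝕋) (x : 𝕋) : overlap A B x ≠ ∞ := measure_ne_top _ _

lemma volume_sub_left_mem {B : Set 𝕋} (hB : MeasurableSet B) (x : 𝕋) :
    volume {s | x - s ∈ B} = volume B :=
  (Measure.measurePreserving_sub_left (volume : Measure 𝕋) x).measure_preimage hB.nullMeasurableSet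

lemma overlap_le_right (A : Set 𝕋) {B : Set 𝕋} (hB : MeasurableSet B) (x : 𝕋) :
    overlap A B x ≤ volume B :=
  (measure_mono inter_subset_right).trans (volume_sub_left_mem hB x).le

lemma volume_add_volume_le_overlap {A B : Set 𝕋} (hA : MeasurableSet A) (hB : MeasurableSet B)
    (x : 𝕋) : volume A + volume B ≤ overlap A B x + 1 := by
  rw [← volume_sub_left_mem hB x, ← measure_union_add_inter' hA, add_comm]
  exact add_le_add_right prob_le_one _

lemma overlap_inter_add_overlap_union (A A' B : Set 𝕋) (hA : MeasurableSet A)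
    (hB : MeasurableSet B) (x : 𝕋) :
    overlap (A ∩ A') B x + overlap (A ∪ A') B x = overlap A B x + overlap A' B x := by
  have hB' : MeasurableSet {s | x - s ∈ B} := (measurable_const.sub measurable_id) hB
  unfold overlap
  rw [union_inter_distrib_right, inter_inter_distrib_right, add_comm]
  exact measure_union_add_inter' (hA.inter hB') _

lemma overlap_mono {A A' B B' : Set 𝕋} (hA : A ⊆ A') (hB : B ⊆ B') (x : 𝕋) :
    overlap A B x ≤ overlap A' B' x :=
  measure_mono (inter_subset_inter hA fun _ h => hB h)

lemma ENNReal.min_add_min_le_of_add_eq {p q a b t : ℝ≥0∞} (h : p + q = a + b) (hpa : p ≤ a)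
    (hpb : p ≤ b) (ha : a ≠ ∞) (hb : b ≠ ∞) : min p t + min q t ≤ min a t + min b t := by
  have hpq : p + q ≠ ∞ := h ▸ ENNReal.add_ne_top.2 ⟨ha, hb⟩
  obtain ⟨hp, hq⟩ := ENNReal.add_ne_top.1 hpq
  obtain rfl | ht := eq_or_ne t ∞
  · simp [h]
  lift p to NNReal using hp
  lift q to NNReal using hq
  lift a to NNReal using ha
  lift b to NNReal using hb
  lift t to NNReal using ht
  norm_cast at *
  rw [← NNReal.coe_le_coe] at *
  rw [← NNReal.coe_inj] at h
  push_cast at *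
  grind

/-- Translation invariance. -/
lemma overlap_preimage_sub (A B : Set 𝕋) (y x : 𝕋) :
    overlap ((· - y) ⁻¹' A) B x = overlap A B (x - y) := by
  unfold overlap
  rw [← measure_preimage_add_right volume (-y) (A ∩ _)]
  congr 1
  ext s
  simp [sub_eq_add_neg]

/-- The truncated mass `∫ min(1_A * 1_B, t)`. -/
noncomputable def truncMass (A B : Set 𝕋) (t : ℝ≥0∞) : ℝ≥0∞ := ∫⁻ x, min (overlap A B x) t

lemma truncMass_le (A B : Set 𝕋) (t : ℝ≥0∞) : truncMass A B t ≤ t :=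
  (lintegral_mono fun _ => min_le_right _ _).trans (by simp)

lemma truncMass_preimage_sub (A B : Set 𝕋) (t : ℝ≥0∞) (y : 𝕋) :
    truncMass ((· - y) ⁻¹' A) B t = truncMass A B t := by
  simp only [truncMass, overlap_preimage_sub]
  exact lintegral_sub_right_eq_self (fun x => min (overlap A B x) t) y

lemma truncMass_inter_add_truncMass_union {A A' B : Set 𝕋} (hA : MeasurableSet A)
    (hA' : MeasurableSet A') (hB : MeasurableSet B) (t : ℝ≥0∞) :
    truncMass (A ∩ A') B t + truncMass (A ∪ A') B t ≤ truncMass A B t + truncMass A' B t := by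
  unfold truncMass
  rw [← lintegral_add_left ((measurable_overlap (hA.inter hA') hB).min measurable_const),
    ← lintegral_add_left ((measurable_overlap hA hB).min measurable_const)]
  refine lintegral_mono fun x => ENNReal.min_add_min_le_of_add_eq
    (overlap_inter_add_overlap_union A A' B hA hB x) (overlap_mono inter_subset_left le_rfl x)
    (overlap_mono inter_subset_right le_rfl x) (overlap_ne_top _ _ _)
    (overlap_ne_top _ _ _)

lemma mul_le_truncMass_add {A B : Set 𝕋} (hA : MeasurableSet A) (hB : MeasurableSet B)
    {t δ : ℝ≥0∞} (h : volume A ≤ t + δ) : volume A * volume B ≤ truncMass A B t + δ := by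
  have : truncMass A B t + δ = ∫⁻ x, (min (overlap A B x) t + δ) := by
    rw [lintegral_add_right _ measurable_const]; simp [truncMass]
  rw [this, ← lintegral_overlap hA hB]
  refine lintegral_mono fun x => ?_
  rw [min_add]
  exact le_min (le_add_right le_rfl) ((overlap_le_left _ _ _).trans h)

lemma le_truncMass_add {A B : Set 𝕋} (hA : MeasurableSet A) (hB : MeasurableSet B)
    {t δ : ℝ≥0∞} (h : 1 + t ≤ volume A + volume B + δ) : t ≤ truncMass A B t + δ := by
  have : truncMass A B t + δ = ∫⁻ x, (min (overlap A B x) t + δ) := by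
    rw [lintegral_add_right _ measurable_const]; simp [truncMass]
  have h1 : t = ∫⁻ _ : 𝕋, t := by simp
  rw [this, h1]
  refine lintegral_mono fun x => ?_
  rw [min_add, ← h1]
  refine le_min ?_ (le_add_right le_rfl)
  have h2 := h.trans (add_le_add_left (volume_add_volume_le_overlap hA hB x) δ)
  rw [add_right_comm, add_comm] at h2
  exact (ENNReal.add_le_add_iff_right ENNReal.one_ne_top).1 h2

lemma continuous_volume_inter_preimage_sub {A : Set 𝕋} (hA : MeasurableSet A) :
    Continuous fun y : 𝕋 => volume.real (A ∩ (· - y) ⁻¹' A) := by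
  rw [continuous_iff_continuousAt]
  intro y
  let f : 𝕋 → C(𝕋, 𝕋) := fun y => ⟨(· - y), by fun_prop⟩
  have hf : Continuous f := ContinuousMap.continuous_of_continuous_uncurry _ (by
    change Continuous fun p : 𝕋 × 𝕋 => p.2 - p.1
    fun_prop)
  have h1 := tendsto_measure_symmDiff_preimage_nhds_zero (μ := volume) (ν := volume) (hf.tendsto y)
    (Eventually.of_forall fun z => measurePreserving_sub_right volume z)
    (measurePreserving_sub_right volume y) hA.nullMeasurableSet (measure_ne_top _ _)
  have h2 : Tendsto (fun z => volume.real ((f z ⁻¹' A) ∆ (f y ⁻¹' A))) (𝓝 y) (𝓝 0) := by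
    simpa using! (ENNReal.tendsto_toReal ENNReal.zero_ne_top).comp h1
  refine tendsto_iff_norm_sub_tendsto_zero.2 (squeeze_zero (fun _ => norm_nonneg _) (fun z => ?_) h2)
  have key : ∀ P Q : Set 𝕋, volume.real (A ∩ P) ≤ volume.real (A ∩ Q) + volume.real (P ∆ Q) := by
    intro P Q
    refine (measureReal_mono ?_).trans (measureReal_union_le _ _)
    intro s hs
    by_cases hQ : s ∈ Q
    · exact Or.inl ⟨hs.1, hQ⟩
    · exact Or.inr (Or.inl ⟨hs.2, hQ⟩)
  have k1 := key (f z ⁻¹' A) (f y ⁻¹' A)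
  have k2 := key (f y ⁻¹' A) (f z ⁻¹' A)
  rw [symmDiff_comm] at k2
  rw [Real.norm_eq_abs, abs_le]
  change -_ ≤ volume.real (A ∩ f z ⁻¹' A) - volume.real (A ∩ f y ⁻¹' A) ∧
    volume.real (A ∩ f z ⁻¹' A) - volume.real (A ∩ f y ⁻¹' A) ≤ _
  constructor <;> linarith

lemma exists_volume_inter_preimage_sub_le {A : Set 𝕋} (hA : MeasurableSet A) :
    ∃ y : 𝕋, volume (A ∩ (· - y) ⁻¹' A) ≤ volume A * volume A := by
  have hN : MeasurableSet (Neg.neg ⁻¹' A) := measurable_neg hA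
  have h := lintegral_overlap hA hN
  have h1 : ∀ y, overlap A (Neg.neg ⁻¹' A) y = volume (A ∩ (· - y) ⁻¹' A) := by
    intro y; simp [overlap, preimage]
  have h2 : volume (Neg.neg ⁻¹' A) = volume A := Measure.measure_preimage_neg volume A
  rw [h2] at h
  obtain ⟨y, hy⟩ := exists_le_lintegral (μ := volume) (measurable_overlap hA hN).aemeasurable
  exact ⟨y, by rwa [h, h1] at hy⟩

lemma exists_volume_inter_preimage_sub_eq {A : Set 𝕋} (hA : MeasurableSet A) {p : ℝ}
    (h1 : volume.real A * volume.real A ≤ p) (h2 : p ≤ volume.real A) :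
    ∃ y : 𝕋, volume.real (A ∩ (· - y) ⁻¹' A) = p := by
  obtain ⟨y, hy⟩ := exists_volume_inter_preimage_sub_le hA
  refine mem_range_of_exists_le_of_exists_ge (continuous_volume_inter_preimage_sub hA)
    ⟨y, le_trans ?_ h1⟩ ⟨0, by simpa using h2⟩
  rw [Measure.real, Measure.real, ← ENNReal.toReal_mul]
  exact ENNReal.toReal_mono (ENNReal.mul_ne_top (measure_ne_top _ _) (measure_ne_top _ _)) hy

lemma truncMass_ne_top (A B : Set 𝕋) {t : ℝ≥0∞} (ht : t ≠ ∞) : truncMass A B t ≠ ∞ :=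
  ((truncMass_le A B t).trans_lt ht.lt_top).ne

lemma mul_add_sub_le_truncMass_real {B : Set 𝕋} (hB : MeasurableSet B) {t : ℝ} (ht : 0 < t)
    (htB : t ≤ volume.real B) {A : Set 𝕋} (hA : MeasurableSet A) (h1 : t ≤ volume.real A)
    (h2 : volume.real A ≤ 1 - volume.real B + t) :
    t * (volume.real A + volume.real B - t) ≤ (truncMass A B (ENNReal.ofReal t)).toReal := by
  set b := volume.real B with hb
  have hb1 : b ≤ 1 := measureReal_le_one
  set F : Set 𝕋 → ℝ := fun A => (truncMass A B (ENNReal.ofReal t)).toReal - t * volume.real A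
    with hF
  have htop : ∀ A, truncMass A B (ENNReal.ofReal t) ≠ ∞ := fun A =>
    truncMass_ne_top A B ENNReal.ofReal_ne_top
  by_contra! hcon
  have hFA : F A < t * (b - t) := by simp only [hF]; linarith
  obtain ⟨δ, hδ, hδ1, hδF⟩ : ∃ δ : ℝ, 0 < δ ∧ δ ≤ 1 ∧ F A < t * (b - t) - 3 * δ := by
    refine ⟨min ((t * (b - t) - F A) / 4) 1, lt_min (by linarith) one_pos, min_le_right _ _, ?_⟩
    linarith [min_le_left ((t * (b - t) - F A) / 4) 1]
  set S : Set ℝ := {v | ∃ A, MeasurableSet A ∧ t ≤ volume.real A ∧ volume.real A ≤ 1 - b + t ∧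
    v = F A - δ * volume.real A ^ 2} with hS
  have hbdd : BddBelow S := by
    refine ⟨-2, ?_⟩
    rintro v ⟨A, hA, -, -, rfl⟩
    have : volume.real A ≤ 1 := measureReal_le_one
    have h0 : 0 ≤ volume.real A := measureReal_nonneg
    have := ENNReal.toReal_nonneg (a := truncMass A B (ENNReal.ofReal t))
    simp only [hF]
    nlinarith [mul_le_mul hδ1 (pow_le_one₀ h0 ‹_› : volume.real A ^ 2 ≤ 1) (by positivity)
      zero_le_one, mul_le_mul (htB.trans hb1) ‹volume.real A ≤ 1› h0 zero_le_one]
  have hmem : F A - δ * volume.real A ^ 2 ∈ S := ⟨A, hA, h1, h2, rfl⟩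
  have ht1 : t ≤ 1 := htB.trans hb1
  have hη : 0 < δ * (t * δ) ^ 2 := by positivity
  obtain ⟨_, ⟨E, hE, hE1, hE2, rfl⟩, hlt⟩ :=
    exists_lt_of_csInf_lt ⟨_, hmem⟩ (lt_add_of_pos_right (sInf S) hη)
  have hJA : sInf S ≤ F A - δ * volume.real A ^ 2 := csInf_le hbdd hmem
  have hηδ : δ * (t * δ) ^ 2 ≤ δ := by
    have : (t * δ) ^ 2 ≤ 1 := pow_le_one₀ (by positivity) (mul_le_one₀ ht1 hδ.le hδ1)
    nlinarith
  have hE3 : volume.real E ≤ 1 := measureReal_le_one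
  have hE0 : 0 ≤ volume.real E := measureReal_nonneg
  have hA0 : 0 ≤ δ * volume.real A ^ 2 := by positivity
  have hEsq : δ * volume.real E ^ 2 ≤ δ := by
    nlinarith [pow_le_one₀ (n := 2) hE0 hE3]
  have hvol : ∀ A : Set 𝕋, volume A = ENNReal.ofReal (volume.real A) := fun A => by simp
  have hfin : F E < t * (b - t) - δ := by linarith
  have htr : truncMass E B (ENNReal.ofReal t) =
      ENNReal.ofReal (truncMass E B (ENNReal.ofReal t)).toReal :=
    (ENNReal.ofReal_toReal (htop E)).symm
  rcases lt_or_ge (volume.real E) (t + δ) with hc | hc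
  · have h := mul_le_truncMass_add hE hB (t := ENNReal.ofReal t) (δ := ENNReal.ofReal δ) (by
      rw [hvol, ← ENNReal.ofReal_add ht.le hδ.le]
      exact ENNReal.ofReal_le_ofReal hc.le)
    rw [hvol, hvol B, ← ENNReal.ofReal_mul hE0, htr, ← ENNReal.ofReal_add (by positivity) hδ.le,
      ENNReal.ofReal_le_ofReal_iff (by positivity), ← hb] at h
    simp only [hF] at hfin
    nlinarith [mul_nonneg (sub_nonneg.2 hE1) (sub_nonneg.2 htB)]
  rcases lt_or_ge (1 - b + t - δ) (volume.real E) with hc' | hc'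
  · have h := le_truncMass_add hE hB (t := ENNReal.ofReal t) (δ := ENNReal.ofReal δ) (by
      rw [hvol, hvol B, ← ENNReal.ofReal_add hE0 measureReal_nonneg, ← ENNReal.ofReal_one,
        ← ENNReal.ofReal_add (by positivity) hδ.le, ← ENNReal.ofReal_add zero_le_one ht.le]
      exact ENNReal.ofReal_le_ofReal (by linarith))
    rw [htr, ← ENNReal.ofReal_add (by positivity) hδ.le,
      ENNReal.ofReal_le_ofReal_iff (by positivity)] at h
    simp only [hF] at hfin
    nlinarith [mul_nonneg ht.le (sub_nonneg.2 hE2)]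
  have hpos : 0 < t * δ := by positivity
  have hle : t * δ ≤ δ := by nlinarith
  obtain ⟨y, hy⟩ := exists_volume_inter_preimage_sub_eq hE (p := volume.real E - t * δ)
    (by nlinarith [mul_le_mul hE1 (show δ ≤ 1 - volume.real E by linarith) hδ.le hE0])
    (by linarith)
  have hE' : MeasurableSet ((· - y) ⁻¹' E) := (measurable_sub_const y) hE
  have hyE : volume.real ((· - y) ⁻¹' E) = volume.real E :=
    (measurePreserving_sub_right volume y).measureReal_preimage hE.nullMeasurableSet
  have hyU : volume.real (E ∪ (· - y) ⁻¹' E) = volume.real E + t * δ := by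
    have := measureReal_union_add_inter (μ := volume) (s := E) hE'
    linarith
  have hsub := truncMass_inter_add_truncMass_union hE hE' hB (ENNReal.ofReal t)
  rw [truncMass_preimage_sub] at hsub
  have hsub' := ENNReal.toReal_mono (ENNReal.add_ne_top.2 ⟨htop _, htop _⟩) hsub
  rw [ENNReal.toReal_add (htop _) (htop _), ENNReal.toReal_add (htop _) (htop _)] at hsub'
  have hI : sInf S ≤ _ := csInf_le hbdd ⟨E ∩ (· - y) ⁻¹' E, hE.inter hE', by rw [hy]; linarith,
    by rw [hy]; linarith, rfl⟩
  have hU : sInf S ≤ _ := csInf_le hbdd ⟨E ∪ (· - y) ⁻¹' E, hE.union hE', by rw [hyU]; linarith,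
    by rw [hyU]; linarith, rfl⟩
  simp only [hF] at hI hU hlt
  rw [hy] at hI
  rw [hyU] at hU
  nlinarith

/-- Tao's refinement of Kneser's inequality for the circle. -/
theorem min_le_truncMass_add {A B : Set 𝕋} (hA : MeasurableSet A) (hB : MeasurableSet B)
    {t : ℝ≥0∞} (htA : t ≤ volume A) (htB : t ≤ volume B) :
    min (t * (volume A + volume B)) (t + t * t) ≤ truncMass A B t + t * t := by
  have ht : t ≠ ∞ := (htA.trans_lt (measure_lt_top _ _)).ne
  obtain rfl | ht0 := eq_or_ne t 0
  · simp
  rcases le_or_gt (volume A + volume B) (1 + t) with h | h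
  · refine (min_le_left _ _).trans ?_
    have hA' : volume A ≠ ∞ := measure_ne_top _ _
    have hB' : volume B ≠ ∞ := measure_ne_top _ _
    rw [← ENNReal.toReal_le_toReal (by finiteness)
      (ENNReal.add_ne_top.2 ⟨truncMass_ne_top A B ht, by finiteness⟩),
      ENNReal.toReal_add (truncMass_ne_top A B ht) (by finiteness)]
    rw [← ENNReal.toReal_le_toReal (by finiteness) (by finiteness),
      ENNReal.toReal_add hA' hB', ENNReal.toReal_add (by simp) ht] at h
    have := mul_add_sub_le_truncMass_real hB (t := t.toReal) (ENNReal.toReal_pos ht0 ht)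
      (ENNReal.toReal_mono hB' htB) hA (ENNReal.toReal_mono hA' htA)
      (by simp only [Measure.real, ENNReal.toReal_one] at h ⊢; linarith)
    rw [ENNReal.ofReal_toReal ht] at this
    simp only [ENNReal.toReal_mul, ENNReal.toReal_add hA' hB', Measure.real] at this ⊢
    linarith
  · refine (min_le_right _ _).trans (add_le_add_left ?_ _)
    simpa using le_truncMass_add hA hB (t := t) (δ := 0) (by simpa using h.le)

lemma min_le_volume_of_add_subset {E I P : Set 𝕋} (hE : MeasurableSet E) (hI : MeasurableSet I)
    (hE0 : volume E ≠ 0) (hI0 : volume I ≠ 0) (hP : ∀ s ∈ E, ∀ u ∈ I, s + u ∈ P) :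
    min (volume E + volume I) 1 ≤ volume P := by
  refine ENNReal.le_of_forall_pos_le_add fun ε hε _ => ?_
  set τ : ℝ≥0∞ := min ε (min (volume E) (volume I)) with hτ
  have hτ0 : τ ≠ 0 := by simp [hτ, hE0, hI0, hε.ne']
  have hτt : τ ≠ ∞ := by simp [hτ]
  have h := min_le_truncMass_add hE hI (t := τ) (by simp [hτ]) (by simp [hτ])
  have h2 : truncMass E I τ ≤ τ * volume P := by
    have : ∀ x, min (overlap E I x) τ ≤ (toMeasurable volume P).indicator (fun _ => τ) x := by
      intro x
      by_cases hx : x ∈ toMeasurable volume P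
      · simp [hx]
      · have : E ∩ {s | x - s ∈ I} = ∅ := by
          ext s
          simp only [mem_inter_iff, mem_ofPred_eq, mem_empty_iff_false, iff_false, not_and]
          intro hs hs'
          exact hx (subset_toMeasurable _ _ (by simpa using hP s hs _ hs'))
        simp [hx, overlap, this]
    calc _ ≤ _ := lintegral_mono this
      _ = _ := by rw [lintegral_indicator_const (measurableSet_toMeasurable _ _),
        measure_toMeasurable]
  have h3 : τ * min (volume E + volume I) 1 ≤ τ * (volume P + τ) := by
    rw [mul_add]
    refine le_trans ?_ (add_le_add_left h2 _)
    refine le_trans ?_ h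
    refine le_min (by gcongr; exact min_le_left _ _) ?_
    refine le_add_right ?_
    calc τ * _ ≤ τ * 1 := by gcongr; exact min_le_right _ _
      _ = τ := mul_one _
  refine ((ENNReal.mul_le_mul_iff_right hτ0 hτt).1 h3).trans ?_
  gcongr
  exact min_le_left _ _

/-- A set that is a union of balls centred at `0`. -/
def Centred (C : Set 𝕋) : Prop := ∀ x ∈ C, ∀ y, ‖y‖ ≤ ‖x‖ → y ∈ C

/-- A function that decreases as its argument moves away from `0`. -/
def NormAntitone (k : 𝕋 → ℝ≥0∞) : Prop := ∀ x y, ‖x‖ ≤ ‖y‖ → k y ≤ k x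

lemma centred_closedBall (r : ℝ) : Centred (Metric.closedBall 0 r) := by
  intro x hx y hy
  simp only [mem_closedBall_zero_iff] at *
  exact hy.trans hx

lemma centred_univ : Centred univ := fun _ _ _ _ => trivial

lemma centred_empty : Centred ∅ := fun _ h => h.elim

lemma Centred.inter {C D : Set 𝕋} (hC : Centred C) (hD : Centred D) : Centred (C ∩ D) :=
  fun x hx y hy => ⟨hC x hx.1 y hy, hD x hx.2 y hy⟩

lemma NormAntitone.centred_lt {k : 𝕋 → ℝ≥0∞} (hk : NormAntitone k) (s : ℝ≥0∞) :
    Centred {x | s < k x} := fun x hx y hy => lt_of_lt_of_le hx (hk y x hy)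

lemma Centred.subset_or_subset {C D : Set 𝕋} (hC : Centred C) (hD : Centred D) :
    C ⊆ D ∨ D ⊆ C := by
  by_contra! h
  obtain ⟨⟨x, hx, hx'⟩, ⟨y, hy, hy'⟩⟩ := And.intro (not_subset.1 h.1) (not_subset.1 h.2)
  obtain hxy | hxy := le_total ‖x‖ ‖y‖
  · exact hx' (hD y hy x hxy)
  · exact hy' (hC x hx y hxy)

lemma Centred.nullMeasurableSet {C : Set 𝕋} (hC : Centred C) : NullMeasurableSet C := by
  obtain rfl | ⟨z, hz⟩ := C.eq_empty_or_nonempty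
  · exact MeasurableSet.empty.nullMeasurableSet
  have hbdd : BddAbove (norm '' C) := by
    refine ⟨1 / 2, ?_⟩
    rintro _ ⟨x, -, rfl⟩
    simpa using AddCircle.norm_le_half_period (1 : ℝ) one_ne_zero (x := x)
  set r := sSup (norm '' C)
  have h1 : C ⊆ Metric.closedBall 0 r := fun x hx =>
    mem_closedBall_zero_iff.2 (le_csSup hbdd (mem_image_of_mem _ hx))
  have h2 : Metric.ball 0 r ⊆ C := by
    intro x hx
    obtain ⟨_, ⟨y, hy, rfl⟩, hxy⟩ := exists_lt_of_lt_csSup ⟨_, mem_image_of_mem _ hz⟩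
      (mem_ball_zero_iff.1 hx)
    exact hC y hy x hxy.le
  have h3 : (Metric.closedBall (0 : 𝕋) r) =ᵐ[volume] Metric.ball 0 r :=
    AddCircle.closedBall_ae_eq_ball
  have h4 : C =ᵐ[volume] Metric.ball 0 r :=
    (h1.eventuallyLE.trans h3.le).antisymm h2.eventuallyLE
  exact Metric.isOpen_ball.measurableSet.nullMeasurableSet.congr h4.symm

lemma Centred.ae_le {C D : Set 𝕋} (hC : Centred C) (hD : Centred D) (h : volume C ≤ volume D) :
    C ≤ᵐ[volume] D := by
  obtain h' | h' := hC.subset_or_subset hD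
  · exact h'.eventuallyLE
  · exact (ae_eq_of_subset_of_measure_ge h' h hD.nullMeasurableSet (measure_ne_top _ _)).symm.le

lemma Centred.ae_eq {C D : Set 𝕋} (hC : Centred C) (hD : Centred D) (h : volume C = volume D) :
    C =ᵐ[volume] D := (hC.ae_le hD h.le).antisymm (hD.ae_le hC h.ge)

lemma Centred.volume_inter {C D : Set 𝕋} (hC : Centred C) (hD : Centred D) :
    volume (C ∩ D) = min (volume C) (volume D) := by
  obtain h | h := hC.subset_or_subset hD
  · rw [inter_eq_left.2 h, min_eq_left (measure_mono h)]
  · rw [inter_eq_right.2 h, min_eq_right (measure_mono h)]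

/-- The closed interval centred at `0` of measure `m`. -/
def cball (m : ℝ≥0∞) : Set 𝕋 := Metric.closedBall 0 (m.toReal / 2)

lemma centred_cball (m : ℝ≥0∞) : Centred (cball m) := centred_closedBall _

lemma measurableSet_cball (m : ℝ≥0∞) : MeasurableSet (cball m) := Metric.isClosed_closedBall.measurableSet

lemma volume_cball {m : ℝ≥0∞} (hm : m ≤ 1) : volume (cball m) = m := by
  have hm' : m ≠ ∞ := (hm.trans_lt ENNReal.one_lt_top).ne
  rw [cball, AddCircle.volume_closedBall, mul_div_cancel₀ _ two_ne_zero, min_eq_right,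
    ENNReal.ofReal_toReal hm']
  exact ENNReal.toReal_mono ENNReal.one_ne_top hm

lemma overlap_congr {A A' B B' : Set 𝕋} (hA : A =ᵐ[volume] A') (hB : B =ᵐ[volume] B') (x : 𝕋) :
    overlap A B x = overlap A' B' x := by
  refine measure_congr (hA.inter ?_)
  exact (Measure.measurePreserving_sub_left (volume : Measure 𝕋) x).quasiMeasurePreserving.preimage_ae_eq hB

lemma exists_coe_eq_abs_le (x : 𝕋) : ∃ r : ℝ, (r : 𝕋) = x ∧ |r| ≤ 1 / 2 ∧ ‖x‖ = |r| := by
  obtain ⟨r, rfl⟩ := QuotientAddGroup.mk_surjective x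
  refine ⟨r - round r, ?_, abs_sub_round r, UnitAddCircle.norm_eq⟩
  rw [AddCircle.coe_sub, sub_eq_self]
  exact (AddCircle.coe_eq_zero_iff (1 : ℝ)).2 ⟨round r, by simp⟩

lemma norm_coe_of_abs_le_one {r : ℝ} (hr : |r| ≤ 1) : ‖(r : 𝕋)‖ = min |r| (1 - |r|) := by
  obtain h | h := le_total |r| (1 / 2)
  · rw [(AddCircle.norm_coe_eq_abs_iff (1 : ℝ) one_ne_zero).2 (by simpa using h), min_eq_left]
    linarith
  · rw [min_eq_right (by linarith)]
    have key : ∀ e : ℝ, |e| = 1 → |r - e| ≤ 1 / 2 → ((e : ℝ) : 𝕋) = 0 → ‖(r : 𝕋)‖ = |r - e| := by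
      intro e _ he h0
      have : (r : 𝕋) = ((r - e : ℝ) : 𝕋) := by rw [AddCircle.coe_sub, h0, sub_zero]
      rw [this]
      exact (AddCircle.norm_coe_eq_abs_iff (1 : ℝ) one_ne_zero).2 (by simpa using he)
    have h1 : ((1 : ℝ) : 𝕋) = 0 := AddCircle.coe_period 1
    have h2 : ((-1 : ℝ) : 𝕋) = 0 := by rw [AddCircle.coe_neg, h1, neg_zero]
    obtain h0 | h0 := le_total 0 r
    · rw [abs_of_nonneg h0] at *
      have : |r - 1| = 1 - r := by rw [abs_of_nonpos] <;> linarith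
      rw [key 1 (by simp) (by rw [this]; linarith) h1, this]
    · rw [abs_of_nonpos h0] at *
      have : |r - -1| = 1 - -r := by rw [abs_of_nonneg] <;> linarith
      rw [key (-1) (by simp) (by rw [this]; linarith) h2, this]

lemma norm_sub_le_norm_add_aux {p a w : ℝ} (hp : |p| ≤ 1 / 2) (ha : |a| ≤ 1 / 2) (hw : |w| ≤ 1 / 2)
    (h1 : ‖((p + a : ℝ) : 𝕋)‖ ≤ ‖((p - a : ℝ) : 𝕋)‖)
    (h2 : ‖((w + a : ℝ) : 𝕋)‖ < ‖((w - a : ℝ) : 𝕋)‖) :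
    ‖((p + w : ℝ) : 𝕋)‖ ≥ ‖((p - w : ℝ) : 𝕋)‖ := by
  rw [abs_le] at *
  rw [norm_coe_of_abs_le_one (by rw [abs_le]; constructor <;> linarith),
    norm_coe_of_abs_le_one (by rw [abs_le]; constructor <;> linarith)] at *
  grind

lemma norm_add_sub_le {x y s : 𝕋} (h1 : ‖x‖ ≤ ‖y‖) (h2 : ‖s - y‖ < ‖s - x‖) :
    ‖x + y - s‖ ≤ ‖s‖ := by
  obtain ⟨r, rfl⟩ := QuotientAddGroup.mk_surjective x
  obtain ⟨r', rfl⟩ := QuotientAddGroup.mk_surjective y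
  obtain ⟨p, hp, hp', -⟩ := exists_coe_eq_abs_le (((r + r') / 2 : ℝ) : 𝕋)
  obtain ⟨a, ha, ha', -⟩ := exists_coe_eq_abs_le (((r - r') / 2 : ℝ) : 𝕋)
  obtain ⟨w, hw, hw', -⟩ := exists_coe_eq_abs_le (s - (((r + r') / 2 : ℝ) : 𝕋))
  have hs : s = ((p + w : ℝ) : 𝕋) := by rw [AddCircle.coe_add, hp, hw]; abel
  have hx : (r : 𝕋) = ((p + a : ℝ) : 𝕋) := by
    rw [AddCircle.coe_add, hp, ha, ← AddCircle.coe_add]; congr 1; ring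
  have hy : (r' : 𝕋) = ((p - a : ℝ) : 𝕋) := by
    rw [AddCircle.coe_sub, hp, ha, ← AddCircle.coe_sub]; congr 1; ring
  change ‖(r : 𝕋)‖ ≤ ‖(r' : 𝕋)‖ at h1
  change ‖s - (r' : 𝕋)‖ < ‖s - (r : 𝕋)‖ at h2
  change ‖(r : 𝕋) + (r' : 𝕋) - s‖ ≤ ‖s‖
  rw [hx, hy] at *
  rw [hs, ← AddCircle.coe_sub, ← AddCircle.coe_sub] at h2
  rw [hs, ← AddCircle.coe_add, ← AddCircle.coe_sub]
  have := norm_sub_le_norm_add_aux hp' ha' hw' h1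
    (by convert h2 using 3 <;> ring)
  convert this using 3; ring

lemma Centred.neg_mem_iff {C : Set 𝕋} (hC : Centred C) {x : 𝕋} : -x ∈ C ↔ x ∈ C :=
  ⟨fun h => hC _ h _ (by simp), fun h => hC _ h _ (by simp)⟩

lemma Centred.normAntitone_overlap {A B : Set 𝕋} (hA : Centred A) (hB : Centred B) :
    NormAntitone (overlap A B) := by
  intro x y hxy
  have hq : ∀ z : 𝕋, NullMeasurableSet {s | z - s ∈ B} := fun z =>
    hB.nullMeasurableSet.preimage
      (Measure.measurePreserving_sub_left (volume : Measure 𝕋) z).quasiMeasurePreserving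
  have hσ := Measure.measurePreserving_sub_left (volume : Measure 𝕋) (x + y)
  unfold overlap
  rw [← measure_inter_add_sdiff₀ (A ∩ {s | y - s ∈ B}) (hq x),
    ← measure_inter_add_sdiff₀ (A ∩ {s | x - s ∈ B}) (hq y)]
  refine add_le_add (measure_mono ?_) ?_
  · rintro s ⟨⟨h1, h2⟩, h3⟩
    exact ⟨⟨h1, h3⟩, h2⟩
  · rw [← hσ.measure_preimage
      ((hA.nullMeasurableSet.inter (hq x)).diff (hq y))]
    refine measure_mono ?_
    rintro s ⟨⟨h1, h2⟩, h3⟩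
    simp only [mem_ofPred_eq] at h2 h3
    have h4 : ‖s - y‖ < ‖s - x‖ := by
      by_contra! h
      exact h3 (hB _ h2 _ (by rwa [norm_sub_rev, norm_sub_rev y]))
    refine ⟨⟨hA s h1 _ (norm_add_sub_le hxy h4), ?_⟩, ?_⟩
    · rw [mem_ofPred_eq, ← hB.neg_mem_iff]
      convert h2 using 1
      change -(x - (x + y - s)) = y - s
      abel
    · rw [mem_ofPred_eq, ← hB.neg_mem_iff]
      convert h3 using 2
      change -(y - (x + y - s)) = x - s
      abel

lemma overlap_cball_tsub_le {a b t : ℝ≥0∞} (ha : a ≤ 1) (hb : b ≤ 1) (hta : t ≤ a) (htb : t ≤ b)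
    (x : 𝕋) : overlap (cball (a - t)) (cball (b - t)) x ≤ overlap (cball a) (cball b) x - t := by
  obtain h0 | h0 := eq_or_ne (overlap (cball (a - t)) (cball (b - t)) x) 0
  · simp [h0]
  obtain rfl | ht := eq_or_ne t 0
  · simp
  have ha' : a ≠ ∞ := (ha.trans_lt ENNReal.one_lt_top).ne
  have hb' : b ≠ ∞ := (hb.trans_lt ENNReal.one_lt_top).ne
  have ht' : t ≠ ∞ := (hta.trans_lt ha'.lt_top).ne
  refine ENNReal.le_sub_of_add_le_right ht' ?_
  have hE : MeasurableSet (cball (a - t) ∩ {s | x - s ∈ cball (b - t)}) :=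
    (measurableSet_cball _).inter ((measurable_const.sub measurable_id) (measurableSet_cball _))
  have h1 : overlap (cball (a - t)) (cball (b - t)) x + t ≤ 1 := by
    refine le_trans (add_le_add_left (overlap_le_left _ _ _) _) ?_
    rwa [volume_cball (tsub_le_self.trans ha), tsub_add_cancel_of_le hta]
  have h2 := min_le_volume_of_add_subset hE (measurableSet_cball t) h0
    (by rwa [volume_cball (hta.trans ha)]) (P := cball a ∩ {s | x - s ∈ cball b}) ?_
  · rw [volume_cball (hta.trans ha)] at h2
    exact (le_min le_rfl h1).trans h2
  · rintro s ⟨hs, hs'⟩ u hu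
    simp only [cball, mem_ofPred_eq, mem_closedBall_zero_iff, mem_inter_iff,
      ENNReal.toReal_sub_of_le hta ha', ENNReal.toReal_sub_of_le htb hb'] at *
    constructor
    · linarith [norm_add_le s u]
    · rw [← sub_sub]
      linarith [norm_sub_le (x - s) u]

lemma ENNReal.le_of_add_eq_add {x y H K : ℝ≥0∞} (hx : x ≤ y) (hy : y ≠ ∞) (h : y + H = x + K) :
    H ≤ K :=
  (ENNReal.add_le_add_iff_left hy).1 (h.le.trans (add_le_add_left hx K))

lemma truncMass_add_lintegral_tsub {A B : Set 𝕋} (hA : MeasurableSet A) (hB : MeasurableSet B)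
    (t : ℝ≥0∞) : truncMass A B t + ∫⁻ x, (overlap A B x - t) = volume A * volume B := by
  rw [truncMass, ← lintegral_add_left ((measurable_overlap hA hB).min measurable_const),
    ← lintegral_overlap hA hB]
  refine lintegral_congr fun x => ?_
  rw [add_comm, tsub_add_min]

/-- The Riesz rearrangement inequality on the circle, for truncated convolutions. -/
theorem lintegral_overlap_tsub_le {A B A' B' : Set 𝕋} (hA : MeasurableSet A)
    (hB : MeasurableSet B) (cA : Centred A') (cB : Centred B') (hA' : volume A' = volume A)
    (hB' : volume B' = volume B) (t : ℝ≥0∞) :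
    ∫⁻ x, (overlap A B x - t) ≤ ∫⁻ x, (overlap A' B' x - t) := by
  set a := volume A with ha
  set b := volume B with hb
  have ha1 : a ≤ 1 := prob_le_one
  have hb1 : b ≤ 1 := prob_le_one
  have hk : ∀ x, overlap A' B' x = overlap (cball a) (cball b) x := overlap_congr
    (cA.ae_eq (centred_cball _) (by rw [volume_cball ha1, hA']))
    (cB.ae_eq (centred_cball _) (by rw [volume_cball hb1, hB']))
  simp_rw [hk]
  by_cases htab : t ≤ a ∧ t ≤ b
  swap
  · have : ∀ x, overlap A B x - t = 0 := fun x => by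
      refine tsub_eq_zero_of_le ?_
      rw [not_and_or, not_le, not_le] at htab
      exact htab.elim (fun h => (overlap_le_left _ _ _).trans h.le)
        (fun h => (overlap_le_right _ hB _).trans h.le)
    simp [this]
  obtain ⟨hta, htb⟩ := htab
  have ht : t ≠ ∞ := (hta.trans_lt (measure_lt_top _ _)).ne
  have h1 := truncMass_add_lintegral_tsub hA hB t
  have h2 := truncMass_add_lintegral_tsub (measurableSet_cball a) (measurableSet_cball b) t
  rw [volume_cball ha1, volume_cball hb1] at h2
  have h3 := min_le_truncMass_add hA hB hta htb
  rw [← ha, ← hb] at h1 h3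
  rw [min_le_iff] at h3
  obtain h3 | h3 := h3
  · refine le_trans ?_ (lintegral_mono fun x => overlap_cball_tsub_le ha1 hb1 hta htb x)
    rw [lintegral_overlap (measurableSet_cball _) (measurableSet_cball _),
      volume_cball (tsub_le_self.trans ha1), volume_cball (tsub_le_self.trans hb1)]
    obtain ⟨a', ha'⟩ := exists_add_of_le hta
    obtain ⟨b', hb'⟩ := exists_add_of_le htb
    clear_value a b
    rw [ha', hb'] at h1 h3 ⊢
    rw [ENNReal.add_sub_cancel_left ht, ENNReal.add_sub_cancel_left ht]
    refine ENNReal.le_of_add_eq_add (x := t * t + t * a' + t * b') (y := truncMass A B t) ?_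
      (truncMass_ne_top A B ht) (by rw [h1]; ring)
    refine (ENNReal.add_le_add_iff_right (ENNReal.mul_ne_top ht ht)).1 (le_trans (le_of_eq ?_) h3)
    ring
  · refine ENNReal.le_of_add_eq_add (x := truncMass (cball a) (cball b) t) (y := truncMass A B t)
      ?_ (truncMass_ne_top A B ht) (h1.trans h2.symm)
    exact (truncMass_le _ _ _).trans
      ((ENNReal.add_le_add_iff_right (ENNReal.mul_ne_top ht ht)).1 h3)

lemma NormAntitone.exists_lintegral_eq {k : 𝕋 → ℝ≥0∞} (hk : NormAntitone k)
    (hk1 : ∀ x, k x ≤ 1) {C : Set 𝕋} (hC : Centred C) :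
    ∃ l ≤ (1 : ℝ≥0∞), ∫⁻ x in C, k x = l * volume C + ∫⁻ x, (k x - l) := by
  set l := ⨆ y : {y // y ∉ C}, k y with hl
  refine ⟨l, iSup_le fun _ => hk1 _, ?_⟩
  have h1 : ∀ x ∈ C, l ≤ k x := fun x hx => iSup_le fun y => hk x y <| by
    by_contra! h
    exact y.2 (hC x hx y h.le)
  have h2 : ∀ x ∉ C, k x ≤ l := fun x hx => le_iSup (fun y : {y // y ∉ C} => k y) ⟨x, hx⟩
  have h3 : ∫⁻ x, (k x - l) = ∫⁻ x in C, (k x - l) := by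
    rw [← lintegral_indicator₀ hC.nullMeasurableSet]
    refine lintegral_congr fun x => ?_
    by_cases hx : x ∈ C
    · simp [hx]
    · simp [hx, tsub_eq_zero_of_le (h2 x hx)]
  rw [h3, ← setLIntegral_const, ← lintegral_add_left measurable_const,
    ← lintegral_indicator₀ hC.nullMeasurableSet, ← lintegral_indicator₀ hC.nullMeasurableSet]
  refine lintegral_congr fun x => ?_
  by_cases hx : x ∈ C
  · simp [hx, add_tsub_cancel_of_le (h1 x hx)]
  · simp [hx]

lemma setLIntegral_le_mul_add_lintegral_tsub (h : 𝕋 → ℝ≥0∞) (l : ℝ≥0∞) (D : Set 𝕋) :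
    ∫⁻ x in D, h x ≤ l * volume D + ∫⁻ x in D, (h x - l) := by
  rw [← setLIntegral_const, ← lintegral_add_left measurable_const]
  exact lintegral_mono fun x => le_add_tsub

/-- The function `h` is dominated, in the sense of rearrangements, by the function `k`, which is
symmetric decreasing. -/
structure Dominated (h k : 𝕋 → ℝ≥0∞) : Prop where
  measurable_left : Measurable h
  measurable_right : Measurable k
  left_le_one : ∀ x, h x ≤ 1
  right_le_one : ∀ x, k x ≤ 1
  normAntitone : NormAntitone k
  setLIntegral_le : ∀ D, MeasurableSet D → ∀ C, Centred C → volume D ≤ volume C →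
    ∫⁻ x in D, h x ≤ ∫⁻ x in C, k x

lemma dominated_overlap {A B A' B' : Set 𝕋} (hA : MeasurableSet A)
    (hB : MeasurableSet B) (mA : MeasurableSet A') (mB : MeasurableSet B')
    (cA : Centred A') (cB : Centred B') (hA' : volume A' = volume A)
    (hB' : volume B' = volume B) : Dominated (overlap A B) (overlap A' B') where
  measurable_left := measurable_overlap hA hB
  measurable_right := measurable_overlap mA mB
  left_le_one _ := prob_le_one
  right_le_one _ := prob_le_one
  normAntitone := cA.normAntitone_overlap cB
  setLIntegral_le D _ C hC hDC := by
    obtain ⟨l, -, hl⟩ := (cA.normAntitone_overlap cB).exists_lintegral_eq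
      (fun _ => prob_le_one) hC
    rw [hl]
    refine (setLIntegral_le_mul_add_lintegral_tsub _ l D).trans ?_
    refine add_le_add (mul_le_mul_right hDC _) ?_
    exact (setLIntegral_le_lintegral _ _).trans (lintegral_overlap_tsub_le hA hB cA cB hA' hB' l)

lemma dominated_one : Dominated (fun _ => 1) (fun _ => 1) where
  measurable_left := measurable_const
  measurable_right := measurable_const
  left_le_one _ := le_rfl
  right_le_one _ := le_rfl
  normAntitone _ _ _ := le_rfl
  setLIntegral_le D _ C _ h := by simpa using h

lemma dominated_lintegral {α : Type*} [MeasurableSpace α] {μ : Measure α} [IsProbabilityMeasure μ]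
    {h k : α → 𝕋 → ℝ≥0∞} (hh : Measurable (Function.uncurry h))
    (hk : Measurable (Function.uncurry k)) (H : ∀ᵐ v ∂μ, Dominated (h v) (k v)) :
    Dominated (fun x => ∫⁻ v, h v x ∂μ) (fun x => ∫⁻ v, k v x ∂μ) where
  measurable_left := Measurable.lintegral_prod_left hh
  measurable_right := Measurable.lintegral_prod_left hk
  left_le_one x := (lintegral_mono_ae (H.mono fun v hv => hv.left_le_one x)).trans (by simp)
  right_le_one x := (lintegral_mono_ae (H.mono fun v hv => hv.right_le_one x)).trans (by simp)
  normAntitone x y hxy := lintegral_mono_ae (H.mono fun v hv => hv.normAntitone x y hxy)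
  setLIntegral_le D hD C hC hDC := by
    rw [lintegral_lintegral_swap (f := fun x v => h v x) (hh.comp measurable_swap).aemeasurable,
      lintegral_lintegral_swap (f := fun x v => k v x) (hk.comp measurable_swap).aemeasurable]
    exact lintegral_mono_ae (H.mono fun v hv => hv.setLIntegral_le D hD C hC hDC)

lemma lintegral_indicator_Iio_ofReal {y : ℝ≥0∞} (hy : y ≠ ∞) :
    ∫⁻ s in Ioi (0 : ℝ), {s : ℝ | ENNReal.ofReal s < y}.indicator 1 s = y := by
  have hS : MeasurableSet {s : ℝ | ENNReal.ofReal s < y} :=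
    ENNReal.measurable_ofReal measurableSet_Iio
  rw [lintegral_indicator_one hS, Measure.restrict_apply hS]
  have : {s : ℝ | ENNReal.ofReal s < y} ∩ Ioi 0 = Ioo 0 y.toReal := by
    ext s
    simp only [mem_inter_iff, mem_ofPred_eq, mem_Ioi, mem_Ioo]
    constructor
    · rintro ⟨h1, h2⟩
      exact ⟨h2, (ENNReal.ofReal_lt_iff_lt_toReal h2.le hy).1 h1⟩
    · rintro ⟨h1, h2⟩
      exact ⟨(ENNReal.ofReal_lt_iff_lt_toReal h1.le hy).2 h2, h1⟩
  rw [this, Real.volume_Ioo, sub_zero, ENNReal.ofReal_toReal hy]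

/-- Layer cake formula. -/
lemma lintegral_mul_eq_lintegral_lt {α : Type*} [MeasurableSpace α] {μ : Measure α} [SFinite μ]
    {f g : α → ℝ≥0∞} (hf : Measurable f) (hg : Measurable g) (hf' : ∀ x, f x ≠ ∞) :
    ∫⁻ x, g x * f x ∂μ =
      ∫⁻ s in Ioi (0 : ℝ), ∫⁻ x in {x | ENNReal.ofReal s < f x}, g x ∂μ := by
  have hS : MeasurableSet {p : α × ℝ | ENNReal.ofReal p.2 < f p.1} :=
    measurableSet_lt (ENNReal.measurable_ofReal.comp measurable_snd) (hf.comp measurable_fst)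
  calc
    _ = ∫⁻ x, (∫⁻ s in Ioi (0 : ℝ),
        {p : α × ℝ | ENNReal.ofReal p.2 < f p.1}.indicator (fun p => g p.1) (x, s)) ∂μ := by
      refine lintegral_congr fun x => ?_
      rw [← lintegral_indicator_Iio_ofReal (hf' x), ← lintegral_const_mul]
      · refine lintegral_congr fun s => ?_
        by_cases h : ENNReal.ofReal s < f x <;> simp [indicator, h]
      · exact measurable_const.indicator (ENNReal.measurable_ofReal measurableSet_Iio)
    _ = ∫⁻ s in Ioi (0 : ℝ), (∫⁻ x,
        {p : α × ℝ | ENNReal.ofReal p.2 < f p.1}.indicator (fun p => g p.1) (x, s) ∂μ) :=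
      lintegral_lintegral_swap (f := fun x s =>
        {p : α × ℝ | ENNReal.ofReal p.2 < f p.1}.indicator (fun p => g p.1) (x, s))
        ((hg.comp measurable_fst).indicator hS).aemeasurable
    _ = _ := by
      refine lintegral_congr fun s => ?_
      rw [← lintegral_indicator (measurableSet_lt measurable_const hf)]
      rfl

lemma setLIntegral_mul_eq_lintegral_lt
    {f g : 𝕋 → ℝ≥0∞} (hf : Measurable f) (hg : Measurable g) (hf' : ∀ x, f x ≠ ∞) (D : Set 𝕋) :
    ∫⁻ x in D, g x * f x =
      ∫⁻ s in Ioi (0 : ℝ), ∫⁻ x in {x | ENNReal.ofReal s < f x} ∩ D, g x := by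
  rw [lintegral_mul_eq_lintegral_lt hf hg hf']
  refine lintegral_congr fun s => ?_
  rw [Measure.restrict_restrict (measurableSet_lt measurable_const hf)]

lemma setLIntegral_eq_lintegral_volume_lt
    {f : 𝕋 → ℝ≥0∞} (hf : Measurable f) (hf' : ∀ x, f x ≠ ∞) (D : Set 𝕋) :
    ∫⁻ x in D, f x =
      ∫⁻ s in Ioi (0 : ℝ), volume ({x | ENNReal.ofReal s < f x} ∩ D) := by
  simpa using setLIntegral_mul_eq_lintegral_lt hf measurable_one hf' D

lemma antitone_volume_lt (f : 𝕋 → ℝ≥0∞) (D : Set 𝕋) :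
    Antitone fun s : ℝ => volume ({x | ENNReal.ofReal s < f x} ∩ D) := fun _ _ h =>
  measure_mono (inter_subset_inter_left _ fun _ hx => (ENNReal.ofReal_le_ofReal h).trans_lt hx)

lemma lintegral_min_volume_lt_le {f : 𝕋 → ℝ≥0∞} (hf : Measurable f) (hf' : ∀ x, f x ≠ ∞)
    (D : Set 𝕋) (N : ℝ≥0∞) {l : ℝ≥0∞} (hl : l ≠ ∞) :
    ∫⁻ s in Ioi (0 : ℝ), min N (volume ({x | ENNReal.ofReal s < f x} ∩ D)) ≤
      l * N + ∫⁻ x in D, (f x - l) := by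
  have hmin : ∫⁻ x in D, min (f x) l ≠ ∞ := by
    refine ne_top_of_le_ne_top (ENNReal.mul_ne_top hl (measure_ne_top volume D)) ?_
    rw [← setLIntegral_const]
    exact lintegral_mono fun _ => min_le_right _ _
  refine (ENNReal.add_le_add_iff_right hmin).1 ?_
  rw [add_assoc, ← lintegral_add_right _ (hf.min measurable_const)]
  simp_rw [tsub_add_min]
  have hg : Measurable fun x => min (f x) l := hf.min measurable_const
  rw [setLIntegral_eq_lintegral_volume_lt hf hf', setLIntegral_eq_lintegral_volume_lt hg
    (fun x => ((min_le_right _ _).trans_lt hl.lt_top).ne)]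
  have hlN : l * N = ∫⁻ s in Ioi (0 : ℝ), {s : ℝ | ENNReal.ofReal s < l}.indicator 1 s * N := by
    have hS : MeasurableSet {s : ℝ | ENNReal.ofReal s < l} :=
      ENNReal.measurable_ofReal measurableSet_Iio
    rw [lintegral_mul_const _ (measurable_one.indicator hS), lintegral_indicator_Iio_ofReal hl]
  rw [hlN, ← lintegral_add_right _ (antitone_volume_lt _ D).measurable,
    ← lintegral_add_right _ (antitone_volume_lt _ D).measurable]
  refine lintegral_mono fun s => ?_
  by_cases h : ENNReal.ofReal s < l
  · simp only [lt_min_iff, h, and_true, indicator_of_mem, mem_ofPred_eq, Pi.one_apply, one_mul]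
    gcongr
    exact min_le_left _ _
  · simp [h]

lemma Dominated.setLIntegral_tsub_le {h k : 𝕋 → ℝ≥0∞} (H : Dominated h k) {D : Set 𝕋}
    (hD : MeasurableSet D) {l : ℝ≥0∞} (hl : l ≠ ∞) :
    ∫⁻ x in D, (h x - l) ≤ ∫⁻ x, (k x - l) := by
  set D' := D ∩ {x | l < h x}
  have hD' : MeasurableSet D' := hD.inter (measurableSet_lt measurable_const H.measurable_left)
  have h1 : ∫⁻ x in D, (h x - l) = ∫⁻ x in D', (h x - l) := by
    rw [← lintegral_indicator hD, ← lintegral_indicator hD']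
    refine lintegral_congr fun x => ?_
    by_cases hx : x ∈ D <;> by_cases hx' : l < h x <;> simp [D', indicator, hx, hx']
    exact tsub_eq_zero_of_le (le_of_not_gt hx')
  have h2 : ∫⁻ x in D', h x = l * volume D' + ∫⁻ x in D', (h x - l) := by
    rw [← setLIntegral_const, ← lintegral_add_left measurable_const]
    refine setLIntegral_congr_fun hD' fun x hx => ?_
    exact (add_tsub_cancel_of_le hx.2.le).symm
  have hv : volume (cball (volume D')) = volume D' := volume_cball prob_le_one
  have h3 := (H.setLIntegral_le D' hD' _ (centred_cball (volume D')) hv.ge).trans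
    (setLIntegral_le_mul_add_lintegral_tsub k l _)
  rw [h2, hv] at h3
  rw [h1]
  exact ((ENNReal.add_le_add_iff_left (ENNReal.mul_ne_top hl (measure_ne_top _ _))).1 h3).trans
    (setLIntegral_le_lintegral _ _)

theorem Dominated.mul {h₁ k₁ h₂ k₂ : 𝕋 → ℝ≥0∞} (H₁ : Dominated h₁ k₁) (H₂ : Dominated h₂ k₂) :
    Dominated (fun x => h₁ x * h₂ x) (fun x => k₁ x * k₂ x) where
  measurable_left := H₁.measurable_left.mul H₂.measurable_left
  measurable_right := H₁.measurable_right.mul H₂.measurable_right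
  left_le_one x := mul_le_one' (H₁.left_le_one x) (H₂.left_le_one x)
  right_le_one x := mul_le_one' (H₁.right_le_one x) (H₂.right_le_one x)
  normAntitone x y hxy := mul_le_mul' (H₁.normAntitone x y hxy) (H₂.normAntitone x y hxy)
  setLIntegral_le D hD C hC hDC := by
    have f2 : ∀ x, h₂ x ≠ ∞ := fun x => ne_top_of_le_ne_top ENNReal.one_ne_top (H₂.left_le_one x)
    have g1 : ∀ x, k₁ x ≠ ∞ := fun x => ne_top_of_le_ne_top ENNReal.one_ne_top (H₁.right_le_one x)
    set m : ℝ → ℝ≥0∞ := fun s => volume ({x | ENNReal.ofReal s < h₂ x} ∩ D)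
    set N : ℝ → ℝ≥0∞ := fun s => volume ({x | ENNReal.ofReal s < k₁ x} ∩ C)
    have hm : Measurable m := (antitone_volume_lt h₂ D).measurable
    have hN : Measurable N := (antitone_volume_lt k₁ C).measurable
    have hmv : ∀ s, volume (cball (m s)) = m s := fun s => volume_cball prob_le_one
    calc
      ∫⁻ x in D, h₁ x * h₂ x
        = ∫⁻ s in Ioi (0 : ℝ), ∫⁻ x in {x | ENNReal.ofReal s < h₂ x} ∩ D, h₁ x :=
          setLIntegral_mul_eq_lintegral_lt H₂.measurable_left H₁.measurable_left f2 D
      _ ≤ ∫⁻ s in Ioi (0 : ℝ), ∫⁻ x in cball (m s), k₁ x :=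
          lintegral_mono fun s => H₁.setLIntegral_le _
            ((measurableSet_lt measurable_const H₂.measurable_left).inter hD) _
            (centred_cball _) (hmv s).ge
      _ = ∫⁻ s in Ioi (0 : ℝ), ∫⁻ s' in Ioi (0 : ℝ), min (N s') (m s) := by
          refine lintegral_congr fun s => ?_
          rw [setLIntegral_eq_lintegral_volume_lt H₁.measurable_right g1]
          refine lintegral_congr fun s' => ?_
          have h1 := H₁.normAntitone.centred_lt (ENNReal.ofReal s')
          have h2 : m s ≤ volume C := (measure_mono inter_subset_right).trans hDC
          rw [h1.volume_inter (centred_cball _), hmv]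
          change _ = min (volume ({x | ENNReal.ofReal s' < k₁ x} ∩ C)) (m s)
          rw [h1.volume_inter hC, min_assoc, min_eq_right h2]
      _ = ∫⁻ s' in Ioi (0 : ℝ), ∫⁻ s in Ioi (0 : ℝ), min (N s') (m s) :=
          lintegral_lintegral_swap
            ((hN.comp measurable_snd).min (hm.comp measurable_fst)).aemeasurable
      _ ≤ ∫⁻ s' in Ioi (0 : ℝ), ∫⁻ x in {x | ENNReal.ofReal s' < k₁ x} ∩ C, k₂ x := by
          refine lintegral_mono fun s' => ?_
          obtain ⟨l, hl, hl'⟩ := H₂.normAntitone.exists_lintegral_eq H₂.right_le_one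
            ((H₁.normAntitone.centred_lt (ENNReal.ofReal s')).inter hC)
          have hl0 : l ≠ ∞ := ne_top_of_le_ne_top ENNReal.one_ne_top hl
          rw [hl']
          refine (lintegral_min_volume_lt_le H₂.measurable_left f2 D _ hl0).trans ?_
          refine add_le_add_right ?_ _
          exact H₂.setLIntegral_tsub_le hD hl0
      _ = ∫⁻ x in C, k₂ x * k₁ x :=
          (setLIntegral_mul_eq_lintegral_lt H₁.measurable_right H₂.measurable_right g1 C).symm
      _ = _ := by simp_rw [mul_comm]

lemma dominated_prod {ι : Type*} {h k : ι → 𝕋 → ℝ≥0∞} (s : Finset ι)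
    (H : ∀ i, Dominated (h i) (k i)) :
    Dominated (fun x => ∏ i ∈ s, h i x) (fun x => ∏ i ∈ s, k i x) := by
  classical
  induction s using Finset.induction_on with
  | empty => simpa using dominated_one
  | insert i s hi ih => simpa [Finset.prod_insert hi] using (H i).mul ih

theorem lintegral_prod_le_of_dominated {ι : Type*} {h k : ι → 𝕋 → ℝ≥0∞} (s : Finset ι)
    (H : ∀ i, Dominated (h i) (k i)) : ∫⁻ x, ∏ i ∈ s, h i x ≤ ∫⁻ x, ∏ i ∈ s, k i x := by
  simpa using (dominated_prod s H).setLIntegral_le univ .univ univ centred_univ le_rfl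

lemma norm_add_half (x : 𝕋) : ‖x + ((1 / 2 : ℝ) : 𝕋)‖ = 1 / 2 - ‖x‖ := by
  obtain ⟨r, rfl, hr, hr'⟩ := exists_coe_eq_abs_le x
  rw [hr', ← AddCircle.coe_add]
  rw [abs_le] at hr
  rw [norm_coe_of_abs_le_one (by rw [abs_le]; constructor <;> linarith)]
  rw [abs_of_nonneg (by linarith : 0 ≤ r + 1 / 2)]
  obtain h | h := le_total 0 r
  · rw [abs_of_nonneg h, min_eq_right] <;> linarith
  · rw [abs_of_nonpos h, min_eq_left] <;> linarith

lemma Centred.preimage_compl {A : Set 𝕋} (hA : Centred A) :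
    Centred ((· + ((1 / 2 : ℝ) : 𝕋)) ⁻¹' Aᶜ) := by
  intro x hx y hy hyA
  refine hx (hA _ hyA _ ?_)
  rw [norm_add_half, norm_add_half]
  linarith

lemma centred_image_Icc {c : ℝ} (hc : c ≤ 1 / 2) :
    Centred ((fun r : ℝ => (r : 𝕋)) '' Icc (-c) c) := by
  rintro _ ⟨r, hr, rfl⟩ y hy
  obtain ⟨s, rfl, hs, hs'⟩ := exists_coe_eq_abs_le y
  have hr' := abs_le.2 hr
  simp only [(AddCircle.norm_coe_eq_abs_iff (1 : ℝ) one_ne_zero).2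
    (show |r| ≤ |(1 : ℝ)| / 2 by simpa using hr'.trans hc)] at hy
  rw [hs'] at hy
  exact ⟨s, abs_le.1 (hy.trans hr'), rfl⟩

section Fubini

variable {d : ℕ}

/-- The section of `S` over `u`. -/
def fiber (S : Set (Fin (d + 1) → 𝕋)) (u : Fin d → 𝕋) : Set 𝕋 := {t | Fin.cons t u ∈ S}

lemma measurable_cons : Measurable fun p : 𝕋 × (Fin d → 𝕋) => (Fin.cons p.1 p.2 : Fin (d + 1) → 𝕋) := by
  refine measurable_pi_lambda _ fun i => ?_
  refine Fin.cases ?_ (fun j => ?_) i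
  · simpa using measurable_fst
  · simpa [Function.comp_def] using (measurable_pi_apply j).comp measurable_snd

lemma measurableSet_fiber {S : Set (Fin (d + 1) → 𝕋)} (hS : MeasurableSet S) (u : Fin d → 𝕋) :
    MeasurableSet (fiber S u) :=
  (measurable_cons.comp (measurable_id.prodMk measurable_const)) hS

lemma lintegral_eq_lintegral_cons {F : (Fin (d + 1) → 𝕋) → ℝ≥0∞} (hF : Measurable F) :
    ∫⁻ x, F x = ∫⁻ u : Fin d → 𝕋, ∫⁻ t : 𝕋, F (Fin.cons t u) := by
  have e := (volume_preserving_piFinSuccAbove (fun _ : Fin (d + 1) => 𝕋) 0).symm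
  rw [← e.lintegral_comp hF, Measure.volume_eq_prod, lintegral_prod_symm]
  · simp [MeasurableEquiv.piFinSuccAbove_symm_apply, Fin.insertNthEquiv]
  · exact (hF.comp e.measurable).aemeasurable

lemma volume_eq_lintegral_fiber {S : Set (Fin (d + 1) → 𝕋)} (hS : MeasurableSet S) :
    volume S = ∫⁻ u, volume (fiber S u) := by
  rw [← lintegral_indicator_one hS, lintegral_eq_lintegral_cons (measurable_one.indicator hS)]
  refine lintegral_congr fun u => ?_
  rw [← lintegral_indicator_one (measurableSet_fiber hS u)]
  rfl

/-- The measure of the set of `y ∈ B` whose translate `A + y` avoids `x`. -/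
noncomputable def avoid {G : Type*} [Sub G] [MeasureSpace G] (A B : Set G) (x : G) : ℝ≥0∞ :=
  volume {y | y ∈ B ∧ x - y ∉ A}

lemma measurable_avoid {A B : Set (Fin d → 𝕋)} (hA : MeasurableSet A) (hB : MeasurableSet B) :
    Measurable (avoid A B) :=
  measurable_measure_prodMk_left
    (s := {p : (Fin d → 𝕋) × (Fin d → 𝕋) | p.2 ∈ B ∧ p.1 - p.2 ∉ A})
    ((measurable_snd hB).inter ((measurable_fst.sub measurable_snd) hA.compl))

lemma cons_sub_cons' (t s : 𝕋) (u v : Fin d → 𝕋) :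
    (Fin.cons t u - Fin.cons s v : Fin (d + 1) → 𝕋) = Fin.cons (t - s) (u - v) := by
  ext i
  refine Fin.cases ?_ (fun j => ?_) i <;> simp

lemma avoid_cons {A B : Set (Fin (d + 1) → 𝕋)} (hA : MeasurableSet A) (hB : MeasurableSet B)
    (t : 𝕋) (u : Fin d → 𝕋) :
    avoid A B (Fin.cons t u) = ∫⁻ v, overlap (fiber B v) (fiber A (u - v))ᶜ t := by
  have hS : MeasurableSet {y | y ∈ B ∧ Fin.cons t u - y ∉ A} :=
    hB.inter ((measurable_const.sub measurable_id) hA.compl)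
  rw [avoid, volume_eq_lintegral_fiber hS]
  refine lintegral_congr fun v => ?_
  congr 1
  ext s
  change Fin.cons s v ∈ B ∧ (Fin.cons t u - Fin.cons s v : Fin (d + 1) → 𝕋) ∉ A ↔
    Fin.cons s v ∈ B ∧ Fin.cons (t - s) (u - v) ∉ A
  rw [cons_sub_cons']

lemma measurable_overlap_fiber {A B : Set (Fin (d + 1) → 𝕋)} (hA : MeasurableSet A)
    (hB : MeasurableSet B) (u : Fin d → 𝕋) (c : 𝕋) :
    Measurable (Function.uncurry fun (v : Fin d → 𝕋) t =>
      overlap (fiber B v) ((· + c) ⁻¹' (fiber A (u - v))ᶜ) t) := by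
  refine measurable_measure_prodMk_left (s := {p : ((Fin d → 𝕋) × 𝕋) × 𝕋 |
    (Fin.cons p.2 p.1.1 : Fin (d + 1) → 𝕋) ∈ B ∧
      (Fin.cons (p.1.2 - p.2 + c) (u - p.1.1) : Fin (d + 1) → 𝕋) ∉ A}) ?_
  have h1 : Measurable fun p : ((Fin d → 𝕋) × 𝕋) × 𝕋 => (p.2, p.1.1) := by fun_prop
  have h2 : Measurable fun p : ((Fin d → 𝕋) × 𝕋) × 𝕋 => (p.1.2 - p.2 + c, u - p.1.1) := by
    fun_prop
  exact ((measurable_cons.comp h1) hB).inter ((measurable_cons.comp h2) hA.compl)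

/-- Almost all sections of `S'` are centred with the measure of the corresponding section
of `S`. -/
def FiberSymm (S S' : Set (Fin (d + 1) → 𝕋)) : Prop :=
  ∀ᵐ u, Centred (fiber S' u) ∧ volume (fiber S' u) = volume (fiber S u)

lemma FiberSymm.volume_eq {S S' : Set (Fin (d + 1) → 𝕋)} (h : FiberSymm S S')
    (hS : MeasurableSet S) (hS' : MeasurableSet S') : volume S' = volume S := by
  rw [volume_eq_lintegral_fiber hS, volume_eq_lintegral_fiber hS']
  exact lintegral_congr_ae (h.mono fun u hu => hu.2)

lemma FiberSymm.dominated {A A' B B' : Set (Fin (d + 1) → 𝕋)} (hA : MeasurableSet A)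
    (hB : MeasurableSet B) (hA' : MeasurableSet A') (hB' : MeasurableSet B')
    (sA : FiberSymm A A') (sB : FiberSymm B B') (u : Fin d → 𝕋) :
    Dominated (fun t => avoid A B (Fin.cons t u))
      (fun t => avoid A' B' (Fin.cons (t + ((1 / 2 : ℝ) : 𝕋)) u)) := by
  simp_rw [avoid_cons hA hB, avoid_cons hA' hB']
  have h1 : ∀ (v : Fin d → 𝕋) (t : 𝕋),
      overlap (fiber B' v) (fiber A' (u - v))ᶜ (t + ((1 / 2 : ℝ) : 𝕋)) =
      overlap (fiber B' v) ((· + ((1 / 2 : ℝ) : 𝕋)) ⁻¹' (fiber A' (u - v))ᶜ) t := by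
    intro v t
    unfold overlap
    congr 2
    ext s
    simp only [mem_ofPred_eq, mem_preimage]
    rw [sub_add_eq_add_sub]
  simp_rw [h1]
  refine dominated_lintegral (h := fun v t => overlap (fiber B v) (fiber A (u - v))ᶜ t)
    (by simpa using measurable_overlap_fiber hA hB u 0)
    (measurable_overlap_fiber hA' hB' u _) ?_
  have : (volume : Measure (Fin d → 𝕋)).IsNegInvariant := Measure.pi.isNegInvariant _
  have sA' := (Measure.measurePreserving_sub_left (volume : Measure (Fin d → 𝕋))
    u).quasiMeasurePreserving.ae sA
  filter_upwards [sA', sB] with v hv hv'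
  have mA := (measurableSet_fiber hA (u - v)).compl
  have mA' := (measurableSet_fiber hA' (u - v)).compl
  refine dominated_overlap (measurableSet_fiber hB v) mA (measurableSet_fiber hB' v)
    ((measurable_add_const _) mA') hv'.1 hv.1.preimage_compl hv'.2 ?_
  rw [measure_preimage_add_right, measure_compl mA.of_compl (measure_ne_top _ _),
    measure_compl mA'.of_compl (measure_ne_top _ _), hv.2]

lemma FiberSymm.lintegral_prod_avoid_le {n : ℕ} {A A' B B' : Fin n → Set (Fin (d + 1) → 𝕋)}
    (hA : ∀ i, MeasurableSet (A i)) (hB : ∀ i, MeasurableSet (B i))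
    (hA' : ∀ i, MeasurableSet (A' i)) (hB' : ∀ i, MeasurableSet (B' i))
    (sA : ∀ i, FiberSymm (A i) (A' i)) (sB : ∀ i, FiberSymm (B i) (B' i)) :
    ∫⁻ x, ∏ i, avoid (A i) (B i) x ≤ ∫⁻ x, ∏ i, avoid (A' i) (B' i) x := by
  rw [lintegral_eq_lintegral_cons
      (Finset.measurable_prod _ fun i _ => measurable_avoid (hA i) (hB i)),
    lintegral_eq_lintegral_cons
      (Finset.measurable_prod _ fun i _ => measurable_avoid (hA' i) (hB' i))]
  refine lintegral_mono fun u => ?_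
  refine (lintegral_prod_le_of_dominated Finset.univ fun i =>
    FiberSymm.dominated (hA i) (hB i) (hA' i) (hB' i) (sA i) (sB i) u).trans ?_
  exact (lintegral_add_right_eq_self
    (fun t => ∏ i, avoid (A' i) (B' i) (Fin.cons t u)) ((1 / 2 : ℝ) : 𝕋)).le

end Fubini

section Union

variable {d n : ℕ}

lemma lintegral_iUnion_add_lintegral_prod_avoid {A B : Fin n → Set (Fin d → 𝕋)}
    (hA : ∀ i, MeasurableSet (A i)) (hB : ∀ i, MeasurableSet (B i)) :
    (∫⁻ y in univ.pi B, volume (⋃ i, (· + y i) '' (A i))) + ∫⁻ x, ∏ i, avoid (A i) (B i) x =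
      ∏ i, volume (B i) := by
  have hBm : MeasurableSet (univ.pi B) := MeasurableSet.univ_pi hB
  set S : Set ((Fin n → Fin d → 𝕋) × (Fin d → 𝕋)) := {p | ∀ i, p.2 - p.1 i ∉ A i} with hS
  have hSm : MeasurableSet S := by
    rw [hS, ofPred_forall]
    refine MeasurableSet.iInter fun i => ?_
    have : Measurable fun p : (Fin n → Fin d → 𝕋) × (Fin d → 𝕋) => p.2 - p.1 i := by fun_prop
    exact this (hA i).compl
  have h1 : ∀ y : Fin n → Fin d → 𝕋,
      (⋃ i, (· + y i) '' (A i)) = (Prod.mk y ⁻¹' S)ᶜ := by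
    intro y
    ext x
    simp [hS, sub_eq_add_neg]
  have h2 : ∫⁻ x, ∏ i, avoid (A i) (B i) x = ∫⁻ y in univ.pi B, volume (Prod.mk y ⁻¹' S) := by
    rw [← Measure.prod_apply hSm, Measure.prod_apply_symm hSm]
    refine lintegral_congr fun x => ?_
    rw [Measure.restrict_apply (measurable_prodMk_right hSm)]
    unfold avoid
    rw [← volume_pi_pi]
    congr 1
    ext y
    simp [hS, forall_and, and_comm]
  rw [h2, ← lintegral_add_right _ (measurable_measure_prodMk_left hSm)]
  simp_rw [h1]
  calc
    _ = ∫⁻ y in univ.pi B, 1 := by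
      refine lintegral_congr fun y => ?_
      rw [add_comm, measure_add_measure_compl (measurable_prodMk_left hSm)]
      exact measure_univ
    _ = _ := by simp [volume_pi_pi]

end Union

section Matrix

variable {d : ℕ}

lemma mmap_add (M : Matrix (Fin d) (Fin d) ℤ) (x y : Fin d → 𝕋) :
    mmap M (x + y) = mmap M x + mmap M y := by
  ext i
  simp [mmap, Finset.sum_add_distrib]

lemma mmap_mmap (M N : Matrix (Fin d) (Fin d) ℤ) (x : Fin d → 𝕋) :
    mmap M (mmap N x) = mmap (M * N) x := by
  ext i
  simp only [mmap, Matrix.mul_apply, Finset.smul_sum, Finset.sum_smul, mul_smul]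
  exact Finset.sum_comm

lemma mmap_one (x : Fin d → 𝕋) : mmap 1 x = x := by
  ext i
  simp [mmap, Matrix.one_apply, ite_smul]

lemma continuous_mmap (M : Matrix (Fin d) (Fin d) ℤ) : Continuous (mmap M) :=
  continuous_pi fun _ => continuous_finsetSum _ fun j _ => (continuous_apply j).zsmul _

lemma mmap_sub (M : Matrix (Fin d) (Fin d) ℤ) (x y : Fin d → 𝕋) :
    mmap M (x - y) = mmap M x - mmap M y := by
  rw [eq_sub_iff_add_eq, ← mmap_add, sub_add_cancel]

lemma measurePreserving_mmap {M : Matrix (Fin d) (Fin d) ℤ} (h : Function.Surjective (mmap M)) :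
    MeasurePreserving (mmap M) :=
  AddMonoidHom.measurePreserving (f := AddMonoidHom.mk' (mmap M) (mmap_add M))
    (continuous_mmap M) h rfl

lemma avoid_preimage_mmap {N : Matrix (Fin d) (Fin d) ℤ} (hN : MeasurePreserving (mmap N))
    {A B : Set (Fin d → 𝕋)} (hA : MeasurableSet A) (hB : MeasurableSet B) (x : Fin d → 𝕋) :
    avoid (mmap N ⁻¹' A) (mmap N ⁻¹' B) x = avoid A B (mmap N x) := by
  have hS : MeasurableSet {y | y ∈ B ∧ mmap N x - y ∉ A} :=
    hB.inter ((measurable_const.sub measurable_id) hA.compl)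
  unfold avoid
  rw [← hN.measure_preimage hS.nullMeasurableSet]
  simp only [preimage_ofPred_eq, mem_preimage, mmap_sub]

lemma lintegral_prod_avoid_preimage_mmap {n : ℕ} {N : Matrix (Fin d) (Fin d) ℤ}
    (hN : MeasurePreserving (mmap N)) {A B : Fin n → Set (Fin d → 𝕋)}
    (hA : ∀ i, MeasurableSet (A i)) (hB : ∀ i, MeasurableSet (B i)) :
    ∫⁻ x, ∏ i, avoid (mmap N ⁻¹' A i) (mmap N ⁻¹' B i) x = ∫⁻ x, ∏ i, avoid (A i) (B i) x := by
  simp_rw [fun i => avoid_preimage_mmap hN (hA i) (hB i)]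
  exact hN.lintegral_comp (f := fun x => ∏ i, avoid (A i) (B i) x)
    (Finset.measurable_prod _ fun i _ => measurable_avoid (hA i) (hB i))

lemma IsSteinerT.fiberSymm {M N : Matrix (Fin (d + 1)) (Fin (d + 1)) ℤ}
    (hMN : ∀ S, mmap M '' S = mmap N ⁻¹' S) {S S' : Set (Fin (d + 1) → 𝕋)}
    (h : IsSteinerT M S S') : FiberSymm (mmap N ⁻¹' S) (mmap N ⁻¹' S') := by
  filter_upwards [h] with u hu
  obtain ⟨c, -, hc, h1, h2⟩ := hu
  rw [hMN, hMN] at h2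
  rw [hMN] at h1
  refine ⟨?_, h2⟩
  change Centred {x : 𝕋 | Fin.cons x u ∈ mmap N ⁻¹' S'}
  obtain h1 | h1 := h1
  · rw [h1]
    exact centred_image_Icc hc
  · rw [h1]
    exact centred_empty

end Matrix

theorem stmt10 (d n : ℕ) (hn : 1 ≤ n)
    (M : Matrix (Fin (d + 1)) (Fin (d + 1)) ℤ) (hM : M.det = 1)
    (X Y XM YM : Fin n → Set (Fin (d + 1) → 𝕋))
    (hXm : ∀ i, MeasurableSet (X i)) (hYm : ∀ i, MeasurableSet (Y i))
    (hXMm : ∀ i, MeasurableSet (XM i)) (hYMm : ∀ i, MeasurableSet (YM i))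
    (hX0 : ∀ i, 0 < volume (X i)) (hY0 : ∀ i, 0 < volume (Y i))
    (hX : ∀ i, IsSteinerT M (X i) (XM i)) (hY : ∀ i, IsSteinerT M (Y i) (YM i)) :
    expUnionT X Y ≥ expUnionT XM YM := by
  set N := M.adjugate
  have h1 : Function.LeftInverse (mmap N) (mmap M) := fun x => by
    rw [mmap_mmap, Matrix.adjugate_mul, hM, one_smul, mmap_one]
  have h2 : Function.RightInverse (mmap N) (mmap M) := fun x => by
    rw [mmap_mmap, Matrix.mul_adjugate, hM, one_smul, mmap_one]
  have hMN : ∀ S, mmap M '' S = mmap N ⁻¹' S := fun S =>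
    congrFun (image_eq_preimage_of_inverse h1 h2) S
  have hN : MeasurePreserving (mmap N) := measurePreserving_mmap h1.surjective
  have sX := fun i => (hX i).fiberSymm hMN
  have sY := fun i => (hY i).fiberSymm hMN
  have mp : ∀ S, MeasurableSet S → MeasurableSet (mmap N ⁻¹' S) := fun S hS => hN.measurable hS
  have hvol : ∀ i, volume (YM i) = volume (Y i) := fun i => by
    rw [← hN.measure_preimage (hYm i).nullMeasurableSet,
      ← hN.measure_preimage (hYMm i).nullMeasurableSet]
    exact (sY i).volume_eq (mp _ (hYm i)) (mp _ (hYMm i))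
  have key := FiberSymm.lintegral_prod_avoid_le (fun i => mp _ (hXm i)) (fun i => mp _ (hYm i))
    (fun i => mp _ (hXMm i)) (fun i => mp _ (hYMm i)) sX sY
  rw [lintegral_prod_avoid_preimage_mmap hN hXm hYm,
    lintegral_prod_avoid_preimage_mmap hN hXMm hYMm] at key
  have e1 := lintegral_iUnion_add_lintegral_prod_avoid hXm hYm
  have e2 := lintegral_iUnion_add_lintegral_prod_avoid hXMm hYMm
  simp_rw [hvol] at e2
  have hP : ∏ i, volume (Y i) ≠ ∞ := ENNReal.prod_ne_top fun i _ => measure_ne_top _ _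
  have hP0 : ∏ i, volume (Y i) ≠ 0 := Finset.prod_ne_zero_iff.2 fun i _ => (hY0 i).ne'
  have le : ∫⁻ y in univ.pi YM, volume (⋃ i, (· + y i) '' (XM i)) ≤
      ∫⁻ y in univ.pi Y, volume (⋃ i, (· + y i) '' (X i)) := by
    refine ENNReal.le_of_add_eq_add key (ne_top_of_le_ne_top hP (e2 ▸ le_add_self)) ?_
    exact (add_comm _ _).trans (e2.trans (e1.symm.trans (add_comm _ _)))
  unfold expUnionT
  simp_rw [hvol]
  refine ENNReal.toReal_mono (ENNReal.mul_ne_top (ENNReal.inv_ne_top.2 hP0)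
    (ne_top_of_le_ne_top hP (e1 ▸ le_self_add))) ?_
  gcongr
end
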